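/- arXiv:1810.00122 — 3 statements merged into one kernel-verified Lean document; each statement's English description precedes it below -/
import Mathlib

section
/- Convergence of BNGD to a global minimizer for small learning rate: Suppose ε_a ∈ (0, 1] and the initial values satisfy a₀·(w₀ᵀg) > 0. Then there exists a constant ε₀ > 0, depending only on H, u, a₀ and ε_a (in the paper ε₀ = 1/(2·C̃_a·κ·λ_max) where C̃_a·√(uᵀHu) ≥ 1 is any bound on sup_k |a_k|), such that whenever ε/‖w₀‖² < ε₀, the BNGD iterates (a_k, w_k) converge to a global minimizer of the BN-OLS objective, i.e., to a limit (a*, w*) with w* a nonzero scalar multiple of u and a* = w*ᵀg/σ(w*). -/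
open Matrix Filter Topology

noncomputable section

/-- A continuous quadratic function is dominated by any
continuous quadratic function that is positive away from the origin. -/
theorem exists_le_mul_of_quadratic {d : ℕ} (f q : (Fin d → ℝ) → ℝ)
    (hf : Continuous f) (hq : Continuous q)
    (hf2 : ∀ (t : ℝ) v, f (t • v) = t ^ 2 * f v) (hq2 : ∀ (t : ℝ) v, q (t • v) = t ^ 2 * q v)
    (hpos : ∀ v, v ≠ 0 → 0 < q v) :
    ∃ C > (0 : ℝ), ∀ v, f v ≤ C * q v := by
  have hne : ∀ v ∈ Metric.sphere (0 : Fin d → ℝ) 1, q v ≠ 0 := fun v hv =>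
    (hpos v (ne_zero_of_mem_unit_sphere ⟨v, hv⟩)).ne'
  obtain ⟨C, hC⟩ := (isCompact_sphere (0 : Fin d → ℝ) 1).exists_bound_of_continuousOn
    (hf.continuousOn.div hq.continuousOn hne)
  refine ⟨max C 1, by positivity, fun v => ?_⟩
  rcases eq_or_ne v 0 with rfl | hv
  · have h1 := hf2 0 0
    have h2 := hq2 0 0
    simp only [smul_zero] at h1 h2
    rw [h1, h2]; simp
  · have hv' : 0 < ‖v‖ := norm_pos_iff.2 hv
    set x : Fin d → ℝ := ‖v‖⁻¹ • v with hx
    have hxs : x ∈ Metric.sphere (0 : Fin d → ℝ) 1 := by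
      rw [mem_sphere_zero_iff_norm, hx, norm_smul, norm_inv, norm_norm]
      exact inv_mul_cancel₀ hv'.ne'
    have hvx : v = ‖v‖ • x := by rw [hx, smul_smul, mul_inv_cancel₀ hv'.ne', one_smul]
    have hqx : 0 < q x := hpos x (ne_zero_of_mem_unit_sphere ⟨x, hxs⟩)
    have h1 : f x ≤ max C 1 * q x := by
      rw [← div_le_iff₀ hqx]
      exact ((le_abs_self _).trans (hC x hxs)).trans (le_max_left _ _)
    rw [hvx, hf2, hq2]
    nlinarith [mul_le_mul_of_nonneg_left h1 (sq_nonneg ‖v‖)]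

/-- A relaxation scheme converges to the limit of the sequence it tracks. -/
theorem tendsto_of_relaxation {b ρ : ℕ → ℝ} {θ l : ℝ} (hθ : 0 < θ) (hθ1 : θ ≤ 1)
    (hb : ∀ k, b (k + 1) = b k + θ * (ρ k - b k)) (hρ : Tendsto ρ atTop (𝓝 l)) :
    Tendsto b atTop (𝓝 l) := by
  rw [Metric.tendsto_atTop]
  intro δ hδ
  obtain ⟨N, hN⟩ := Metric.tendsto_atTop.1 hρ (δ / 2) (by positivity)
  have key : ∀ k, |b (N + k) - l| ≤ δ / 2 + (1 - θ) ^ k * |b N - l| := by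
    intro k
    induction k with
    | zero => simp; positivity
    | succ k ih =>
      have h1 : |ρ (N + k) - l| < δ / 2 := hN (N + k) (by omega)
      have h2 : b (N + (k + 1)) - l = (1 - θ) * (b (N + k) - l) + θ * (ρ (N + k) - l) := by
        rw [← add_assoc, hb]; ring
      have h3 : |b (N + (k + 1)) - l| ≤ (1 - θ) * |b (N + k) - l| + θ * |ρ (N + k) - l| := by
        rw [h2]
        refine (abs_add_le _ _).trans ?_
        rw [abs_mul, abs_mul, abs_of_pos hθ, abs_of_nonneg (by linarith : 0 ≤ 1 - θ)]
      have h4 := mul_le_mul_of_nonneg_left ih (by linarith : 0 ≤ 1 - θ)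
      have h5 := mul_le_mul_of_nonneg_left h1.le hθ.le
      rw [pow_succ]
      linarith
  have hz : Tendsto (fun k => (1 - θ) ^ k * |b N - l|) atTop (𝓝 0) := by
    simpa using (tendsto_pow_atTop_nhds_zero_of_lt_one (by linarith : 0 ≤ 1 - θ)
      (by linarith)).mul_const |b N - l|
  obtain ⟨K, hK⟩ := (hz.eventually (gt_mem_nhds (half_pos hδ))).exists_forall_of_atTop
  refine ⟨N + K, fun n hn => ?_⟩
  have h1 := key (n - N)
  have h2 := hK (n - N) (by omega)
  rw [show N + (n - N) = n by omega] at h1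
  rw [Real.dist_eq]
  linarith

section Step

variable {d : ℕ} {H : Matrix (Fin d) (Fin d) ℝ}

theorem Matrix.PosDef.dotProduct_mulVec_comm (hH : H.PosDef) (x y : Fin d → ℝ) :
    x ⬝ᵥ H *ᵥ y = y ⬝ᵥ H *ᵥ x := by
  have ht : Hᵀ = H := by simpa using hH.isHermitian.eq
  rw [dotProduct_comm, ← vecMul_transpose, ht, ← dotProduct_mulVec]

theorem Matrix.PosDef.dotProduct_mulVec_self_pos (hH : H.PosDef) {x : Fin d → ℝ} (hx : x ≠ 0) :
    0 < x ⬝ᵥ H *ᵥ x := by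
  simpa using hH.dotProduct_mulVec_pos hx

/-- The squared `H`-norm of the `H`-orthogonal component of `u` relative to `w`. -/
def hResidualSq (H : Matrix (Fin d) (Fin d) ℝ) (u w : Fin d → ℝ) : ℝ :=
  u ⬝ᵥ H *ᵥ u - (w ⬝ᵥ H *ᵥ u) ^ 2 / (w ⬝ᵥ H *ᵥ w)

/-- The component of `u` that is `H`-orthogonal to `w`. -/
def hResidual (H : Matrix (Fin d) (Fin d) ℝ) (u w : Fin d → ℝ) : Fin d → ℝ :=
  u - ((w ⬝ᵥ H *ᵥ u) / (w ⬝ᵥ H *ᵥ w)) • w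

theorem dotProduct_mulVec_sub_smul (hH : H.PosDef) (u w : Fin d → ℝ) (t : ℝ) :
    (u - t • w) ⬝ᵥ H *ᵥ (u - t • w) =
      u ⬝ᵥ H *ᵥ u - 2 * t * (w ⬝ᵥ H *ᵥ u) + t ^ 2 * (w ⬝ᵥ H *ᵥ w) := by
  simp only [mulVec_sub, mulVec_smul, sub_dotProduct, dotProduct_sub, smul_dotProduct,
    dotProduct_smul, smul_eq_mul]
  rw [hH.dotProduct_mulVec_comm u w]
  ring

theorem hResidual_dotProduct (hH : H.PosDef) (u : Fin d → ℝ) {w : Fin d → ℝ} (hw : w ≠ 0) :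
    hResidual H u w ⬝ᵥ H *ᵥ hResidual H u w = hResidualSq H u w := by
  have := (hH.dotProduct_mulVec_self_pos hw).ne'
  rw [hResidual, hResidualSq, dotProduct_mulVec_sub_smul hH]
  field_simp
  ring

theorem dotProduct_mulVec_hResidual (hH : H.PosDef) (u : Fin d → ℝ) {w : Fin d → ℝ}
    (hw : w ≠ 0) : w ⬝ᵥ H *ᵥ hResidual H u w = 0 := by
  have := (hH.dotProduct_mulVec_self_pos hw).ne'
  simp only [hResidual, mulVec_sub, mulVec_smul, dotProduct_sub, dotProduct_smul, smul_eq_mul]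
  field_simp
  ring

theorem hResidualSq_le (hH : H.PosDef) (u : Fin d → ℝ) {w : Fin d → ℝ} (hw : w ≠ 0) (t : ℝ) :
    hResidualSq H u w ≤ (u - t • w) ⬝ᵥ H *ᵥ (u - t • w) := by
  have h := hH.dotProduct_mulVec_self_pos hw
  rw [hResidualSq, dotProduct_mulVec_sub_smul hH]
  have : 0 ≤ (t * (w ⬝ᵥ H *ᵥ w) - w ⬝ᵥ H *ᵥ u) ^ 2 / (w ⬝ᵥ H *ᵥ w) := by positivity
  have e : (t * (w ⬝ᵥ H *ᵥ w) - w ⬝ᵥ H *ᵥ u) ^ 2 / (w ⬝ᵥ H *ᵥ w) =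
    t ^ 2 * (w ⬝ᵥ H *ᵥ w) - 2 * t * (w ⬝ᵥ H *ᵥ u) + (w ⬝ᵥ H *ᵥ u) ^ 2 / (w ⬝ᵥ H *ᵥ w) := by
    field_simp
    ring
  linarith

theorem hResidualSq_nonneg (hH : H.PosDef) (u : Fin d → ℝ) {w : Fin d → ℝ} (hw : w ≠ 0) :
    0 ≤ hResidualSq H u w := by
  rw [← hResidual_dotProduct hH u hw]
  simpa using hH.posSemidef.dotProduct_mulVec_nonneg (hResidual H u w)

theorem step_norm_sq (hH : H.PosDef) (u : Fin d → ℝ) {w : Fin d → ℝ} (hw : w ≠ 0) (α : ℝ) :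
    (w + α • H *ᵥ hResidual H u w) ⬝ᵥ (w + α • H *ᵥ hResidual H u w) =
      w ⬝ᵥ w + α ^ 2 * (H *ᵥ hResidual H u w ⬝ᵥ H *ᵥ hResidual H u w) := by
  simp only [add_dotProduct, dotProduct_add, smul_dotProduct, dotProduct_smul, smul_eq_mul,
    dotProduct_comm (H *ᵥ hResidual H u w) w, dotProduct_mulVec_hResidual hH u hw]
  ring

theorem step_inner (u w : Fin d → ℝ) (α : ℝ) :
    (w + α • H *ᵥ hResidual H u w) ⬝ᵥ H *ᵥ u =
      w ⬝ᵥ H *ᵥ u + α * (H *ᵥ hResidual H u w ⬝ᵥ H *ᵥ hResidual H u w +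
        (w ⬝ᵥ H *ᵥ u) / (w ⬝ᵥ H *ᵥ w) * (H *ᵥ w ⬝ᵥ H *ᵥ hResidual H u w)) := by
  have hu : H *ᵥ u = H *ᵥ hResidual H u w + ((w ⬝ᵥ H *ᵥ u) / (w ⬝ᵥ H *ᵥ w)) • H *ᵥ w := by
    rw [hResidual, mulVec_sub, mulVec_smul, sub_add_cancel]
  have h := congrArg (H *ᵥ hResidual H u w ⬝ᵥ ·) hu
  simp only [dotProduct_add, dotProduct_smul, smul_eq_mul,
    dotProduct_comm (H *ᵥ hResidual H u w) (H *ᵥ w)] at h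
  rw [add_dotProduct, smul_dotProduct, smul_eq_mul, h]

theorem step_hResidualSq (hH : H.PosDef) (u : Fin d → ℝ) {w : Fin d → ℝ} (hw : w ≠ 0) {α η M : ℝ}
    (hw' : w + α • H *ᵥ hResidual H u w ≠ 0)
    (hη : η = α * ((w ⬝ᵥ H *ᵥ u) / (w ⬝ᵥ H *ᵥ w))) (hη0 : 0 ≤ η) (hηM : η * M ≤ 1)
    (hM : ∀ v : Fin d → ℝ, v ⬝ᵥ H *ᵥ v ≤ M * (v ⬝ᵥ v)) :
    hResidualSq H u (w + α • H *ᵥ hResidual H u w) ≤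
      hResidualSq H u w - η * (H *ᵥ hResidual H u w ⬝ᵥ H *ᵥ hResidual H u w) := by
  set t := (w ⬝ᵥ H *ᵥ u) / (w ⬝ᵥ H *ᵥ w) with ht
  set z := H *ᵥ hResidual H u w with hz
  have h1 := hResidualSq_le hH u hw' t
  have h2 : u - t • (w + α • z) = hResidual H u w - η • z := by
    rw [hResidual, hη, smul_add, smul_smul, mul_comm α t, sub_sub]
  rw [h2, dotProduct_mulVec_sub_smul hH, hResidual_dotProduct hH u hw, ← hz] at h1
  have h3 := mul_le_mul_of_nonneg_left (hM z) (sq_nonneg η)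
  have h4 : 0 ≤ z ⬝ᵥ z := by simpa using dotProduct_self_star_nonneg z
  have h5 := mul_le_mul_of_nonneg_right hηM (mul_nonneg hη0 h4)
  nlinarith

theorem dotProduct_sq_le (x y : Fin d → ℝ) : (x ⬝ᵥ y) ^ 2 ≤ (x ⬝ᵥ x) * (y ⬝ᵥ y) := by
  have := Finset.sum_mul_sq_le_sq_mul_sq Finset.univ x y
  simpa [dotProduct, sq] using this

/-- A small step keeps the alignment with `u` positive. -/
theorem step_inner_pos (hH : H.PosDef) (u : Fin d → ℝ) {w : Fin d → ℝ} (hw : w ≠ 0)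
    {α C : ℝ} (hα : 0 ≤ α) (hC : 0 < C)
    (hC2 : ∀ v : Fin d → ℝ, H *ᵥ v ⬝ᵥ H *ᵥ v ≤ C * (v ⬝ᵥ H *ᵥ v))
    (hy : 0 < w ⬝ᵥ H *ᵥ u)
    (hs : α * C * √(u ⬝ᵥ H *ᵥ u) < √(w ⬝ᵥ H *ᵥ w)) :
    0 < (w + α • H *ᵥ hResidual H u w) ⬝ᵥ H *ᵥ u := by
  rw [step_inner]
  have hq := hH.dotProduct_mulVec_self_pos hw
  have hr := hResidual_dotProduct hH u hw
  have hru : hResidualSq H u w ≤ u ⬝ᵥ H *ᵥ u := by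
    rw [hResidualSq]; have : 0 ≤ (w ⬝ᵥ H *ᵥ u) ^ 2 / (w ⬝ᵥ H *ᵥ w) := by positivity
    linarith
  have hru0 := hResidualSq_nonneg hH u hw
  set z := H *ᵥ hResidual H u w
  have hz : 0 ≤ z ⬝ᵥ z := by simpa using dotProduct_self_star_nonneg z
  have h1 : |H *ᵥ w ⬝ᵥ z| ≤ C * √(w ⬝ᵥ H *ᵥ w) * √(u ⬝ᵥ H *ᵥ u) := by
    apply abs_le_of_sq_le_sq _ (by positivity)
    rw [mul_pow, mul_pow, Real.sq_sqrt hq.le, Real.sq_sqrt (hru0.trans hru)]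
    have hz2 : z ⬝ᵥ z ≤ C * (u ⬝ᵥ H *ᵥ u) :=
      (hC2 _).trans (by rw [hr]; exact mul_le_mul_of_nonneg_left hru hC.le)
    calc _ ≤ _ := dotProduct_sq_le _ _
      _ ≤ (C * (w ⬝ᵥ H *ᵥ w)) * (C * (u ⬝ᵥ H *ᵥ u)) :=
        mul_le_mul (hC2 w) hz2 hz (by positivity)
      _ = _ := by ring
  have h2 := (abs_le.1 h1).1
  have hs' := Real.sqrt_pos.2 hq
  have h3 : α * (C * √(w ⬝ᵥ H *ᵥ w) * √(u ⬝ᵥ H *ᵥ u)) < w ⬝ᵥ H *ᵥ w := by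
    nlinarith [mul_lt_mul_of_pos_right hs hs', Real.mul_self_sqrt hq.le]
  have h4 : -(w ⬝ᵥ H *ᵥ w) < α * (H *ᵥ w ⬝ᵥ z) := by nlinarith
  have h5 : -(w ⬝ᵥ H *ᵥ u) < (w ⬝ᵥ H *ᵥ u) / (w ⬝ᵥ H *ᵥ w) * (α * (H *ᵥ w ⬝ᵥ z)) := by
    have := mul_lt_mul_of_pos_left h4 (div_pos hy hq)
    rwa [mul_neg, div_mul_cancel₀ _ hq.ne'] at this
  nlinarith [mul_nonneg hα hz]

/-- The signed `H`-cosine between `u` and `w`, scaled by the `H`-norm of `u`. -/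
def hAlignment (H : Matrix (Fin d) (Fin d) ℝ) (u w : Fin d → ℝ) : ℝ :=
  (w ⬝ᵥ H *ᵥ u) / √(w ⬝ᵥ H *ᵥ w)

theorem hResidualSq_eq (hH : H.PosDef) (u : Fin d → ℝ) {w : Fin d → ℝ} (hw : w ≠ 0) :
    hResidualSq H u w = u ⬝ᵥ H *ᵥ u - hAlignment H u w ^ 2 := by
  rw [hResidualSq, hAlignment, div_pow, Real.sq_sqrt (hH.dotProduct_mulVec_self_pos hw).le]

theorem hAlignment_le (hH : H.PosDef) (u : Fin d → ℝ) {w : Fin d → ℝ} (hw : w ≠ 0) :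
    hAlignment H u w ≤ √(u ⬝ᵥ H *ᵥ u) := by
  apply Real.le_sqrt_of_sq_le
  linarith [hResidualSq_eq hH u hw, hResidualSq_nonneg hH u hw]

/-- Effect of one small step on the norm, the alignment, and the residual. -/
theorem bngd_step (hH : H.PosDef) (u : Fin d → ℝ) {w : Fin d → ℝ} {C₁ C₂ M A ε m ρ₀ a : ℝ}
    (hC₁0 : 0 < C₁) (hC₂0 : 0 < C₂) (hM0 : 0 < M)
    (hC₁ : ∀ v : Fin d → ℝ, v ⬝ᵥ v ≤ C₁ * (v ⬝ᵥ H *ᵥ v))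
    (hC₂ : ∀ v : Fin d → ℝ, H *ᵥ v ⬝ᵥ H *ᵥ v ≤ C₂ * (v ⬝ᵥ H *ᵥ v))
    (hM : ∀ v : Fin d → ℝ, v ⬝ᵥ H *ᵥ v ≤ M * (v ⬝ᵥ v))
    (hUA : √(u ⬝ᵥ H *ᵥ u) ≤ A) (hε : 0 < ε) (hm : 0 < m)
    (hεm : ε * (C₁ * A ^ 2 * (C₂ + M)) < m)
    (ha : 0 < a) (haA : a ≤ A) (hρ₀ : 0 < ρ₀) (hρ : ρ₀ ≤ hAlignment H u w) (hmw : m ≤ w ⬝ᵥ w) :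
    let z := H *ᵥ hResidual H u w
    let w' := w + (ε * (a / √(w ⬝ᵥ H *ᵥ w))) • z
    m ≤ w' ⬝ᵥ w' ∧ 0 < w' ⬝ᵥ H *ᵥ u ∧
      hResidualSq H u w' ≤ hResidualSq H u w -
        ε * a * hAlignment H u w / (w ⬝ᵥ H *ᵥ w) * (z ⬝ᵥ z) ∧
      w' ⬝ᵥ w' + ε * A / ρ₀ * hResidualSq H u w' ≤ w ⬝ᵥ w + ε * A / ρ₀ * hResidualSq H u w := by
  intro z w'
  have ne_of_le : ∀ {v : Fin d → ℝ}, m ≤ v ⬝ᵥ v → v ≠ 0 := by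
    rintro v hv rfl
    simp at hv
    linarith
  have hw := ne_of_le hmw
  have hq := hH.dotProduct_mulVec_self_pos hw
  have hs := Real.sqrt_pos.2 hq
  have hss := Real.sq_sqrt hq.le
  have hρA := (hAlignment_le hH u hw).trans hUA
  have hz : 0 ≤ z ⬝ᵥ z := by simpa using dotProduct_self_star_nonneg z
  have hA : 0 < A := ha.trans_le haA
  have hρpos : 0 < hAlignment H u w := hρ₀.trans_le hρ
  have hy : 0 < w ⬝ᵥ H *ᵥ u := by
    rw [hAlignment] at hρpos
    exact (div_pos_iff_of_pos_right hs).1 hρpos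
  have hsmall : ε * A ^ 2 * (C₂ + M) < w ⬝ᵥ H *ᵥ w := by
    have := hεm.trans_le (hmw.trans (hC₁ w))
    refine lt_of_mul_lt_mul_left ?_ hC₁0.le
    linarith
  have hnorm : w' ⬝ᵥ w' = w ⬝ᵥ w + (ε * (a / √(w ⬝ᵥ H *ᵥ w))) ^ 2 * (z ⬝ᵥ z) :=
    step_norm_sq hH u hw _
  have hmw' : m ≤ w' ⬝ᵥ w' := by
    rw [hnorm]
    have := mul_nonneg (sq_nonneg (ε * (a / √(w ⬝ᵥ H *ᵥ w)))) hz
    linarith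
  have hE : hResidualSq H u w' ≤ hResidualSq H u w -
      ε * a * hAlignment H u w / (w ⬝ᵥ H *ᵥ w) * (z ⬝ᵥ z) := by
    refine step_hResidualSq hH u hw (M := M) (ne_of_le hmw') ?_ (by positivity) ?_ hM
    · rw [hAlignment]
      field_simp
    · rw [div_mul_eq_mul_div, div_le_one hq]
      have h1 : a * hAlignment H u w ≤ A * A := mul_le_mul haA hρA hρpos.le hA.le
      have h2 := mul_le_mul_of_nonneg_left h1 (mul_pos hε hM0).le
      have h3 : 0 < ε * A ^ 2 * C₂ := by positivity
      nlinarith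
  refine ⟨hmw', ?_, hE, ?_⟩
  · refine step_inner_pos hH u hw (by positivity) hC₂0 hC₂ hy ?_
    have e : ε * (a / √(w ⬝ᵥ H *ᵥ w)) * C₂ * √(u ⬝ᵥ H *ᵥ u) =
      ε * C₂ * (a * √(u ⬝ᵥ H *ᵥ u)) / √(w ⬝ᵥ H *ᵥ w) := by ring
    rw [e, div_lt_iff₀ hs, ← sq, hss]
    have h1 : a * √(u ⬝ᵥ H *ᵥ u) ≤ A * A := mul_le_mul haA hUA (Real.sqrt_nonneg _) hA.le
    have h2 := mul_le_mul_of_nonneg_left h1 (mul_pos hε hC₂0).le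
    have h3 : 0 < ε * A ^ 2 * M := by positivity
    nlinarith
  · have h1 := mul_le_mul_of_nonneg_left hE (by positivity : 0 ≤ ε * A / ρ₀)
    have h2 : (ε * (a / √(w ⬝ᵥ H *ᵥ w))) ^ 2 ≤
        ε * A / ρ₀ * (ε * a * hAlignment H u w / (w ⬝ᵥ H *ᵥ w)) := by
      rw [mul_pow, div_pow, hss]
      have h3 : a ^ 2 * ρ₀ ≤ A * a * hAlignment H u w := by
        rw [sq]
        gcongr
      have e1 : ε ^ 2 * (a ^ 2 / (w ⬝ᵥ H *ᵥ w)) =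
        (a ^ 2 * ρ₀) * (ε ^ 2 / (ρ₀ * (w ⬝ᵥ H *ᵥ w))) := by field_simp
      have e2 : ε * A / ρ₀ * (ε * a * hAlignment H u w / (w ⬝ᵥ H *ᵥ w)) =
        (A * a * hAlignment H u w) * (ε ^ 2 / (ρ₀ * (w ⬝ᵥ H *ᵥ w))) := by field_simp
      rw [e1, e2]
      exact mul_le_mul_of_nonneg_right h3 (by positivity)
    have h4 := mul_le_mul_of_nonneg_right h2 hz
    rw [hnorm]
    linarith

/-- Convergence of BNGD when the initial scale and alignment are both positive. -/
theorem bngd_tendsto_of_pos (hH : H.PosDef) {u : Fin d → ℝ} (hu : u ≠ 0)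
    {C₁ C₂ C₃ C₄ M A ε εa : ℝ}
    (hC₁0 : 0 < C₁) (hC₂0 : 0 < C₂) (hC₃0 : 0 < C₃) (hC₄0 : 0 < C₄) (hM0 : 0 < M)
    (hC₁ : ∀ v : Fin d → ℝ, v ⬝ᵥ v ≤ C₁ * (v ⬝ᵥ H *ᵥ v))
    (hC₂ : ∀ v : Fin d → ℝ, H *ᵥ v ⬝ᵥ H *ᵥ v ≤ C₂ * (v ⬝ᵥ H *ᵥ v))
    (hC₃ : ∀ v : Fin d → ℝ, v ⬝ᵥ H *ᵥ v ≤ C₃ * (H *ᵥ v ⬝ᵥ H *ᵥ v))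
    (hC₄ : ∀ v : Fin d → ℝ, ‖H *ᵥ v‖ ^ 2 ≤ C₄ * (v ⬝ᵥ H *ᵥ v))
    (hM : ∀ v : Fin d → ℝ, v ⬝ᵥ H *ᵥ v ≤ M * (v ⬝ᵥ v))
    (hεa : 0 < εa) (hεa1 : εa ≤ 1) (hε : 0 < ε)
    {a : ℕ → ℝ} {w : ℕ → Fin d → ℝ}
    (hUA : √(u ⬝ᵥ H *ᵥ u) ≤ A) (ha₀ : 0 < a 0) (ha₀A : a 0 ≤ A) (hw₀ : 0 < w 0 ⬝ᵥ H *ᵥ u)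
    (hεm : ε * (C₁ * A ^ 2 * (C₂ + M)) < w 0 ⬝ᵥ w 0)
    (ha : ∀ k, a (k + 1) = a k + εa * (hAlignment H u (w k) - a k))
    (hw : ∀ k, w (k + 1) = w k +
      (ε * (a k / √(w k ⬝ᵥ H *ᵥ w k))) • H *ᵥ hResidual H u (w k)) :
    ∃ c : ℝ, c ≠ 0 ∧ Tendsto a atTop (𝓝 (hAlignment H u (c • u))) ∧
      Tendsto w atTop (𝓝 (c • u)) := by
  have hA : 0 < A := ha₀.trans_le ha₀A
  set m := w 0 ⬝ᵥ w 0 with hm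
  have hm0 : 0 < m := lt_of_le_of_lt (by positivity) hεm
  have ne_of_le : ∀ {v : Fin d → ℝ}, m ≤ v ⬝ᵥ v → v ≠ 0 := by
    rintro v hv rfl
    simp at hv
    linarith
  have hw0ne : w 0 ≠ 0 := ne_of_le le_rfl
  set ρ₀ := hAlignment H u (w 0) with hρ₀def
  have hρ₀ : 0 < ρ₀ := div_pos hw₀ (Real.sqrt_pos.2 (hH.dotProduct_mulVec_self_pos hw0ne))
  set L := min (a 0) ρ₀
  have hL : 0 < L := lt_min ha₀ hρ₀
  set E : ℕ → ℝ := fun k => hResidualSq H u (w k) with hEdef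
  set W := m + ε * A / ρ₀ * E 0 with hW
  have align : ∀ k, m ≤ w k ⬝ᵥ w k → 0 < w k ⬝ᵥ H *ᵥ u → E k ≤ E 0 →
      ρ₀ ≤ hAlignment H u (w k) := by
    intro k h1 h2 h3
    have hne := ne_of_le h1
    simp only [hEdef, hResidualSq_eq hH u hne, hResidualSq_eq hH u hw0ne] at h3
    refine (le_abs_self _).trans (abs_le_of_sq_le_sq ?_ (div_pos h2 (Real.sqrt_pos.2 (hH.dotProduct_mulVec_self_pos hne))).le)
    linarith
  have inv : ∀ k, m ≤ w k ⬝ᵥ w k ∧ 0 < w k ⬝ᵥ H *ᵥ u ∧ E k ≤ E 0 ∧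
      w k ⬝ᵥ w k + ε * A / ρ₀ * E k ≤ W ∧ L ≤ a k ∧ a k ≤ A := by
    intro k
    induction k with
    | zero => exact ⟨le_rfl, hw₀, le_rfl, le_rfl, min_le_left _ _, ha₀A⟩
    | succ k ih =>
      obtain ⟨h1, h2, h3, h4, h5, h6⟩ := ih
      have hρ := align k h1 h2 h3
      have hρA := (hAlignment_le hH u (ne_of_le h1)).trans hUA
      have hq := hH.dotProduct_mulVec_self_pos (ne_of_le h1)
      obtain ⟨g1, g2, g3, g4⟩ := bngd_step hH u hC₁0 hC₂0 hM0 hC₁ hC₂ hM hUA hε hm0 hεm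
        (hL.trans_le h5) h6 hρ₀ hρ h1
      rw [← hw] at g1 g2 g3 g4
      have hz : 0 ≤ H *ᵥ hResidual H u (w k) ⬝ᵥ H *ᵥ hResidual H u (w k) := by
        simpa using dotProduct_self_star_nonneg (H *ᵥ hResidual H u (w k))
      have hη : 0 ≤ ε * a k * hAlignment H u (w k) / (w k ⬝ᵥ H *ᵥ w k) := by
        have := hL.trans_le h5
        have := hρ₀.trans_le hρ
        positivity
      refine ⟨g1, g2, ?_, g4.trans h4, ?_, ?_⟩
      · have := mul_nonneg hη hz
        simp only [hEdef] at h3 ⊢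
        linarith
      · rw [ha]
        have : L ≤ hAlignment H u (w k) := (min_le_right _ _).trans hρ
        nlinarith
      · rw [ha]
        nlinarith
  have hE0 : ∀ k, 0 ≤ E k := fun k => hResidualSq_nonneg hH u (ne_of_le (inv k).1)
  have hWpos : 0 < W := by have := hE0 0; positivity
  set τ := min (ε * L * ρ₀ / (M * W) / C₃) (1 / 2) with hτ
  have hτ0 : 0 < τ := by positivity
  have hτ1 : τ ≤ 1 / 2 := min_le_right _ _
  have contract : ∀ k, E (k + 1) ≤ (1 - τ) * E k := by
    intro k
    obtain ⟨h1, h2, h3, h4, h5, h6⟩ := inv k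
    have hρ := align k h1 h2 h3
    have hq := hH.dotProduct_mulVec_self_pos (ne_of_le h1)
    obtain ⟨-, -, g3, -⟩ := bngd_step hH u hC₁0 hC₂0 hM0 hC₁ hC₂ hM hUA hε hm0 hεm
      (hL.trans_le h5) h6 hρ₀ hρ h1
    rw [← hw] at g3
    set z := H *ᵥ hResidual H u (w k) with hz
    have hEz : E k / C₃ ≤ z ⬝ᵥ z := by
      rw [div_le_iff₀' hC₃0]
      simpa only [hResidual_dotProduct hH u (ne_of_le h1)] using hC₃ (hResidual H u (w k))
    have hqW : w k ⬝ᵥ H *ᵥ w k ≤ M * W := by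
      refine (hM _).trans (mul_le_mul_of_nonneg_left ?_ hM0.le)
      have : 0 ≤ ε * A / ρ₀ * E k := mul_nonneg (by positivity) (hE0 k)
      linarith
    have hη : ε * L * ρ₀ / (M * W) ≤
        ε * a k * hAlignment H u (w k) / (w k ⬝ᵥ H *ᵥ w k) := by
      have := hL.trans_le h5
      have := hρ₀.trans_le hρ
      gcongr
    have key : τ * E k ≤
        ε * a k * hAlignment H u (w k) / (w k ⬝ᵥ H *ᵥ w k) * (z ⬝ᵥ z) := by
      calc τ * E k ≤ ε * L * ρ₀ / (M * W) / C₃ * E k :=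
            mul_le_mul_of_nonneg_right (min_le_left _ _) (hE0 k)
        _ = ε * L * ρ₀ / (M * W) * (E k / C₃) := by ring
        _ ≤ _ := mul_le_mul hη hEz (div_nonneg (hE0 k) hC₃0.le)
            (le_trans (by positivity) hη)
    simp only [hEdef] at key ⊢
    linarith
  have geom : ∀ k, E k ≤ (1 - τ) ^ k * E 0 := by
    intro k
    induction k with
    | zero => simp
    | succ k ih =>
      have := mul_le_mul_of_nonneg_left ih (by linarith : 0 ≤ 1 - τ)
      rw [pow_succ]
      linarith [contract k]
  set r := √(1 - τ) with hr
  have hr0 : 0 ≤ r := Real.sqrt_nonneg _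
  have hr1 : r < 1 := by
    rw [hr, Real.sqrt_lt' one_pos]
    linarith
  have hrsq : r ^ 2 = 1 - τ := Real.sq_sqrt (by linarith)
  set D := ε * (A / √(m / C₁)) * √(C₄ * E 0) with hD
  have incr : ∀ k, dist (w k) (w (k + 1)) ≤ D * r ^ k := by
    intro k
    obtain ⟨h1, h2, h3, h4, h5, h6⟩ := inv k
    have hq := hH.dotProduct_mulVec_self_pos (ne_of_le h1)
    have hak := hL.trans_le h5
    rw [hw, dist_self_add_right, norm_smul, Real.norm_of_nonneg (by positivity)]
    have hz : ‖H *ᵥ hResidual H u (w k)‖ ≤ √(C₄ * E 0) * r ^ k := by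
      refine (le_abs_self _).trans (abs_le_of_sq_le_sq ?_ (by positivity))
      rw [mul_pow, Real.sq_sqrt (mul_nonneg hC₄0.le (hE0 0)), ← pow_mul, mul_comm k 2, pow_mul,
        hrsq]
      have h7 := hC₄ (hResidual H u (w k))
      rw [hResidual_dotProduct hH u (ne_of_le h1)] at h7
      have h8 := mul_le_mul_of_nonneg_left (geom k) hC₄0.le
      simp only [hEdef] at h8 ⊢
      linarith
    have hs : √(m / C₁) ≤ √(w k ⬝ᵥ H *ᵥ w k) := by
      apply Real.sqrt_le_sqrt
      rw [div_le_iff₀' hC₁0]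
      exact h1.trans (hC₁ _)
    have hs0 : 0 < √(m / C₁) := Real.sqrt_pos.2 (by positivity)
    calc _ ≤ ε * (A / √(m / C₁)) * (√(C₄ * E 0) * r ^ k) := by gcongr
      _ = D * r ^ k := by rw [hD]; ring
  obtain ⟨w', hw'⟩ := cauchySeq_tendsto_of_complete (cauchySeq_of_le_geometric r D hr1 incr)
  have hcq : Continuous fun v : Fin d → ℝ => v ⬝ᵥ H *ᵥ v := by fun_prop
  have hcu : Continuous fun v : Fin d → ℝ => v ⬝ᵥ H *ᵥ u := by fun_prop
  have hcn : Continuous fun v : Fin d → ℝ => v ⬝ᵥ v := by fun_prop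
  have hw'ne : w' ≠ 0 :=
    ne_of_le (ge_of_tendsto' ((hcn.tendsto w').comp hw') fun k => (inv k).1)
  have hq' := hH.dotProduct_mulVec_self_pos hw'ne
  have hElim : Tendsto E atTop (𝓝 (hResidualSq H u w')) :=
    tendsto_const_nhds.sub ((((hcu.tendsto w').comp hw').pow 2).div ((hcq.tendsto w').comp hw')
      hq'.ne')
  have hEzero : Tendsto E atTop (𝓝 0) := by
    refine squeeze_zero hE0 geom ?_
    simpa using (tendsto_pow_atTop_nhds_zero_of_lt_one (by linarith : 0 ≤ 1 - τ)
      (by linarith)).mul_const (E 0)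
  have hres : hResidual H u w' = 0 := by
    by_contra hne
    have := hH.dotProduct_mulVec_self_pos hne
    rw [hResidual_dotProduct hH u hw'ne, tendsto_nhds_unique hElim hEzero] at this
    exact this.false
  set t := (w' ⬝ᵥ H *ᵥ u) / (w' ⬝ᵥ H *ᵥ w') with ht
  have hut : u = t • w' := sub_eq_zero.1 hres
  have ht0 : t ≠ 0 := by
    intro h
    rw [h, zero_smul] at hut
    exact hu hut
  have hwu : t⁻¹ • u = w' := by
    conv_lhs => rw [hut]
    rw [smul_smul, inv_mul_cancel₀ ht0, one_smul]
  refine ⟨t⁻¹, inv_ne_zero ht0, ?_, ?_⟩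
  · rw [hwu]
    refine tendsto_of_relaxation hεa hεa1 ha ?_
    exact ((hcu.tendsto w').comp hw').div ((hcq.sqrt.tendsto w').comp hw')
      (Real.sqrt_pos.2 hq').ne'
  · rwa [hwu]

end Step

/-- Convergence of BNGD to a global minimizer for small learning rate: if `ε_a ∈ (0,1]`
and `a₀·(w₀ᵀg) > 0`, there is `ε₀ > 0` (depending only on `H`, `u`, `a₀`, `ε_a`) such that
for all initializations with `ε/‖w₀‖² < ε₀` the BNGD iterates converge to a global
minimizer of the BN-OLS objective. -/
theorem bngd_convergence_small_stepsize_signed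
    {d : ℕ} (hd : 0 < d)
    (H : Matrix (Fin d) (Fin d) ℝ) (hH : H.PosDef)
    (u : Fin d → ℝ) (hu : u ≠ 0)
    (εa : ℝ) (hεa : 0 < εa) (hεa1 : εa ≤ 1)
    (g : Fin d → ℝ) (hg : g = H.mulVec u)
    (σ : (Fin d → ℝ) → ℝ) (hσ : ∀ v, σ v = Real.sqrt (v ⬝ᵥ H.mulVec v))
    (a₀ : ℝ) :
    ∃ ε₀ > (0 : ℝ), ∀ w₀ : Fin d → ℝ, w₀ ≠ 0 → a₀ * (w₀ ⬝ᵥ g) > 0 →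
      ∀ ε > (0 : ℝ), ε / (w₀ ⬝ᵥ w₀) < ε₀ →
        ∀ (a : ℕ → ℝ) (w : ℕ → Fin d → ℝ),
          a 0 = a₀ → w 0 = w₀ →
          (∀ k, a (k + 1) = a k + εa * ((w k ⬝ᵥ g) / σ (w k) - a k)) →
          (∀ k, w (k + 1) = w k +
            (ε * (a k / σ (w k))) • (g - ((w k ⬝ᵥ g) / (σ (w k)) ^ 2) • H.mulVec (w k))) →
          ∃ (astar : ℝ) (wstar : Fin d → ℝ) (c : ℝ), c ≠ 0 ∧ wstar = c • u ∧
            astar = (wstar ⬝ᵥ g) / σ wstar ∧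
            Tendsto a atTop (nhds astar) ∧ Tendsto w atTop (nhds wstar) := by
  have hpos : ∀ v : Fin d → ℝ, v ≠ 0 → 0 < v ⬝ᵥ H *ᵥ v :=
    fun v hv => hH.dotProduct_mulVec_self_pos hv
  have hcq : Continuous fun v : Fin d → ℝ => v ⬝ᵥ H *ᵥ v := by fun_prop
  have hcn : Continuous fun v : Fin d → ℝ => v ⬝ᵥ v := by fun_prop
  have hcz : Continuous fun v : Fin d → ℝ => H *ᵥ v ⬝ᵥ H *ᵥ v := by fun_prop
  have hcs : Continuous fun v : Fin d → ℝ => ‖H *ᵥ v‖ ^ 2 := by fun_prop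
  have hq2 : ∀ (t : ℝ) (v : Fin d → ℝ), (t • v) ⬝ᵥ H *ᵥ (t • v) = t ^ 2 * (v ⬝ᵥ H *ᵥ v) := by
    intro t v
    simp [mulVec_smul]
    ring
  have hn2 : ∀ (t : ℝ) (v : Fin d → ℝ), (t • v) ⬝ᵥ (t • v) = t ^ 2 * (v ⬝ᵥ v) := by
    intro t v
    simp
    ring
  have hz2 : ∀ (t : ℝ) (v : Fin d → ℝ), H *ᵥ (t • v) ⬝ᵥ H *ᵥ (t • v) =
      t ^ 2 * (H *ᵥ v ⬝ᵥ H *ᵥ v) := by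
    intro t v
    rw [mulVec_smul, hn2]
  have hs2 : ∀ (t : ℝ) (v : Fin d → ℝ), ‖H *ᵥ (t • v)‖ ^ 2 = t ^ 2 * ‖H *ᵥ v‖ ^ 2 := by
    intro t v
    rw [mulVec_smul, norm_smul, mul_pow, Real.norm_eq_abs, sq_abs]
  have hnpos : ∀ v : Fin d → ℝ, v ≠ 0 → 0 < v ⬝ᵥ v := fun v hv => by
    simpa using dotProduct_self_star_pos_iff.2 hv
  have hzpos : ∀ v : Fin d → ℝ, v ≠ 0 → 0 < H *ᵥ v ⬝ᵥ H *ᵥ v := by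
    intro v hv
    refine hnpos _ fun h => ?_
    have := hpos v hv
    simp [h] at this
  obtain ⟨C₁, hC₁0, hC₁⟩ := exists_le_mul_of_quadratic _ _ hcn hcq hn2 hq2 hpos
  obtain ⟨C₂, hC₂0, hC₂⟩ := exists_le_mul_of_quadratic _ _ hcz hcq hz2 hq2 hpos
  obtain ⟨C₃, hC₃0, hC₃⟩ := exists_le_mul_of_quadratic _ _ hcq hcz hq2 hz2 hzpos
  obtain ⟨C₄, hC₄0, hC₄⟩ := exists_le_mul_of_quadratic _ _ hcs hcq hs2 hq2 hpos
  obtain ⟨M, hM0, hM⟩ := exists_le_mul_of_quadratic _ _ hcq hcn hq2 hn2 hnpos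
  set A := |a₀| + √(u ⬝ᵥ H *ᵥ u) with hA
  have hU : 0 < √(u ⬝ᵥ H *ᵥ u) := Real.sqrt_pos.2 (hpos u hu)
  have hA0 : 0 < A := by positivity
  have hUA : √(u ⬝ᵥ H *ᵥ u) ≤ A := by linarith [abs_nonneg a₀]
  have haA : |a₀| ≤ A := by linarith
  refine ⟨1 / (C₁ * A ^ 2 * (C₂ + M)), by positivity, ?_⟩
  intro w₀ hw₀ hsign ε hε hεlt a w ha0 hw0 ha hw
  subst hg
  have hm := hnpos w₀ hw₀
  have hεm : ε * (C₁ * A ^ 2 * (C₂ + M)) < w 0 ⬝ᵥ w 0 := by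
    rw [div_lt_div_iff₀ hm (by positivity), one_mul] at hεlt
    rwa [hw0]
  have hdir : ∀ k, H *ᵥ u - ((w k ⬝ᵥ H *ᵥ u) / σ (w k) ^ 2) • H *ᵥ w k =
      H *ᵥ hResidual H u (w k) := by
    intro k
    have : 0 ≤ w k ⬝ᵥ H *ᵥ w k := by
      simpa using hH.posSemidef.dotProduct_mulVec_nonneg (w k)
    rw [hσ, Real.sq_sqrt this, hResidual, mulVec_sub, mulVec_smul]
  have ha' : ∀ k, a (k + 1) = a k + εa * (hAlignment H u (w k) - a k) := by
    intro k
    rw [ha, hσ, hAlignment]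
  have hw' : ∀ k, w (k + 1) = w k +
      (ε * (a k / √(w k ⬝ᵥ H *ᵥ w k))) • H *ᵥ hResidual H u (w k) := by
    intro k
    rw [hw, hdir, hσ]
  rcases pos_and_pos_or_neg_and_neg_of_mul_pos hsign with ⟨h1, h2⟩ | ⟨h1, h2⟩
  · obtain ⟨c, hc, hta, htw⟩ := bngd_tendsto_of_pos hH hu hC₁0 hC₂0 hC₃0 hC₄0 hM0 hC₁ hC₂ hC₃ hC₄
      hM hεa hεa1 hε hUA (by rwa [ha0]) (by rw [ha0]; exact (le_abs_self _).trans haA)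
      (by rwa [hw0]) hεm ha' hw'
    exact ⟨_, _, c, hc, rfl, by rw [hσ]; rfl, hta, htw⟩
  · have hal : ∀ v, hAlignment H (-u) v = -hAlignment H u v := by
      intro v
      simp [hAlignment, mulVec_neg, neg_div]
    have hre : ∀ v, hResidual H (-u) v = -hResidual H u v := by
      intro v
      simp only [hResidual, mulVec_neg, dotProduct_neg, neg_div, neg_smul]
      abel
    obtain ⟨c, hc, hta, htw⟩ := bngd_tendsto_of_pos (a := fun k => -a k) hH (neg_ne_zero.2 hu)
      hC₁0 hC₂0 hC₃0 hC₄0 hM0 hC₁ hC₂ hC₃ hC₄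
      hM hεa hεa1 hε (by simpa [mulVec_neg] using hUA) (by simp only [ha0]; linarith)
      (by simp only [ha0]; exact (neg_le_abs _).trans haA)
      (by rw [hw0, mulVec_neg, dotProduct_neg]; linarith) hεm
      (by intro k; rw [hal, ha']; ring)
      (by intro k; rw [hre, hw', mulVec_neg, neg_div, mul_neg, neg_smul_neg])
    refine ⟨_, _, -c, neg_ne_zero.2 hc, rfl, rfl, ?_, ?_⟩
    · rw [hal, smul_neg, ← neg_smul] at hta
      simpa [hσ, hAlignment] using hta.neg
    · simpa using htw
end
end

section
/- Convergence of BNGD for small learning rate (general initial values): Suppose ε_a ∈ (0, 1]. Then there exists a constant ε₀ > 0, depending only on H, u, a₀ and ε_a, such that whenever ε/‖w₀‖² < ε₀, the BNGD iterates (a_k, w_k) converge (the limit being either a global minimizer or a saddle point (a*, w*) with a* = 0 and w*ᵀg = 0 of the BN-OLS objective). -/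
open Matrix Filter Topology

noncomputable section

namespace BNGD

/-- Signed dichotomy for the scalar part of the dynamics. -/
theorem sign_trichotomy {a q : ℕ → ℝ} {εa : ℝ} (h0 : 0 < εa) (h1 : εa ≤ 1)
    (ha : ∀ k, a (k + 1) = a k + εa * (q k - a k))
    (hswap : ∀ k, q k * q (k + 1) ≤ 0 → |q k| ≤ |a k| / 2)
    (hpos : ∀ k, 0 ≤ a k → 0 ≤ q k → q k ≤ q (k + 1))
    (hneg : ∀ k, a k ≤ 0 → q k ≤ 0 → q (k + 1) ≤ q k) :
    (∃ ρ, 0 ≤ ρ ∧ ρ < 1 ∧ ∃ K, ∀ k ≥ K, |a (k + 1)| ≤ ρ * |a k|) ∨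
      (∃ K, 0 < q K ∧ ∀ k ≥ K, 0 ≤ a k ∧ q K ≤ q k) ∨
      (∃ K, q K < 0 ∧ ∀ k ≥ K, a k ≤ 0 ∧ q k ≤ q K) := by
  have ha' : ∀ k, a (k + 1) = (1 - εa) * a k + εa * q k := fun k => by rw [ha]; ring
  have hrate : 0 ≤ 1 - εa := by linarith
  by_cases hopp : ∀ k, a k * q k < 0
  · refine Or.inl ⟨max (1 - εa) (1 / 2), le_max_of_le_left hrate, max_lt (by linarith) (by norm_num),
      0, fun k _ => ?_⟩
    have hm1 : (1 - εa) * |a k| ≤ max (1 - εa) (1 / 2) * |a k| := by gcongr; exact le_max_left _ _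
    have hm2 : 1 / 2 * |a k| ≤ max (1 - εa) (1 / 2) * |a k| := by gcongr; exact le_max_right _ _
    have hk := hopp k
    have hk1 := hopp (k + 1)
    have hs := hswap k
    have hak := ha' k
    have e1 : |q k| ≤ |a k| / 2 → εa * |q k| ≤ 1 / 2 * |a k| := fun h => by
      nlinarith [abs_nonneg (q k)]
    rcases mul_neg_iff.1 hk with ⟨hA, hQ⟩ | ⟨hA, hQ⟩ <;>
    rcases mul_neg_iff.1 hk1 with ⟨hA1, hQ1⟩ | ⟨hA1, hQ1⟩
    · rw [abs_of_pos hA1]; rw [abs_of_pos hA] at *; nlinarith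
    · have := e1 (hs (by nlinarith))
      rw [abs_of_neg hA1]; rw [abs_of_pos hA] at *; rw [abs_of_neg hQ] at *; nlinarith
    · have := e1 (hs (by nlinarith))
      rw [abs_of_pos hA1]; rw [abs_of_neg hA] at *; rw [abs_of_pos hQ] at *; nlinarith
    · rw [abs_of_neg hA1]; rw [abs_of_neg hA] at *; nlinarith
  · push Not at hopp
    obtain ⟨K, hK⟩ := hopp
    rcases mul_nonneg_iff.1 hK with ⟨hA, hQ⟩ | ⟨hA, hQ⟩
    · have key : ∀ k ≥ K, 0 ≤ a k ∧ 0 ≤ q k := by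
        intro k hk
        induction k, hk using Nat.le_induction with
        | base => exact ⟨hA, hQ⟩
        | succ k _ ih =>
          refine ⟨?_, ih.2.trans (hpos k ih.1 ih.2)⟩
          rw [ha']; exact add_nonneg (mul_nonneg hrate ih.1) (mul_nonneg h0.le ih.2)
      by_cases hz : ∃ k ≥ K, 0 < q k
      · obtain ⟨J, hJ, hqJ⟩ := hz
        refine Or.inr (Or.inl ⟨J, hqJ, fun k hk => ⟨(key k (hJ.trans hk)).1, ?_⟩⟩)
        induction k, hk using Nat.le_induction with
        | base => exact le_rfl
        | succ k hk ih =>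
          have := key k (hJ.trans hk)
          exact ih.trans (hpos k this.1 this.2)
      · push Not at hz
        refine Or.inl ⟨1 - εa, hrate, by linarith, K, fun k hk => ?_⟩
        have : q k = 0 := le_antisymm (hz k hk) (key k hk).2
        rw [ha', this, mul_zero, add_zero, abs_mul, abs_of_nonneg hrate]
    · have key : ∀ k ≥ K, a k ≤ 0 ∧ q k ≤ 0 := by
        intro k hk
        induction k, hk using Nat.le_induction with
        | base => exact ⟨hA, hQ⟩
        | succ k _ ih =>
          refine ⟨?_, (hneg k ih.1 ih.2).trans ih.2⟩
          rw [ha']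
          exact add_nonpos (mul_nonpos_of_nonneg_of_nonpos hrate ih.1)
            (mul_nonpos_of_nonneg_of_nonpos h0.le ih.2)
      by_cases hz : ∃ k ≥ K, q k < 0
      · obtain ⟨J, hJ, hqJ⟩ := hz
        refine Or.inr (Or.inr ⟨J, hqJ, fun k hk => ⟨(key k (hJ.trans hk)).1, ?_⟩⟩)
        induction k, hk using Nat.le_induction with
        | base => exact le_rfl
        | succ k hk ih =>
          have := key k (hJ.trans hk)
          exact (hneg k this.1 this.2).trans ih
      · push Not at hz
        refine Or.inl ⟨1 - εa, hrate, by linarith, K, fun k hk => ?_⟩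
        have : q k = 0 := le_antisymm (key k hk).2 (hz k hk)
        rw [ha', this, mul_zero, add_zero, abs_mul, abs_of_nonneg hrate]

/-- Exponential averaging of a convergent sequence converges to the same limit. -/
theorem tendsto_average {a q : ℕ → ℝ} {εa l : ℝ} (h0 : 0 < εa) (h1 : εa ≤ 1)
    (ha : ∀ k, a (k + 1) = a k + εa * (q k - a k)) (hq : Tendsto q atTop (𝓝 l)) :
    Tendsto a atTop (𝓝 l) := by
  rw [Metric.tendsto_atTop] at *
  intro η hη
  obtain ⟨K, hK⟩ := hq (η / 2) (by linarith)
  have hb : ∀ j, |a (K + j) - l| ≤ (1 - εa) ^ j * |a K - l| + η / 2 := by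
    intro j
    induction j with
    | zero => simpa using (half_pos hη).le
    | succ j ih =>
      have e : a (K + (j + 1)) - l = (1 - εa) * (a (K + j) - l) + εa * (q (K + j) - l) := by
        rw [← add_assoc, ha]; ring
      have hq' : |q (K + j) - l| ≤ η / 2 := (hK (K + j) (by omega)).le
      calc _ ≤ |(1 - εa) * (a (K + j) - l)| + |εa * (q (K + j) - l)| := by
            rw [e]; exact abs_add_le _ _
        _ = (1 - εa) * |a (K + j) - l| + εa * |q (K + j) - l| := by
            rw [abs_mul, abs_mul, abs_of_nonneg (by linarith : 0 ≤ 1 - εa), abs_of_pos h0]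
        _ ≤ (1 - εa) * ((1 - εa) ^ j * |a K - l| + η / 2) + εa * (η / 2) := by
            gcongr
        _ = _ := by ring
  have hlim : Tendsto (fun j => (1 - εa) ^ j * |a K - l|) atTop (𝓝 0) := by
    simpa using (tendsto_pow_atTop_nhds_zero_of_lt_one (by linarith : 0 ≤ 1 - εa)
      (by linarith)).mul_const |a K - l|
  obtain ⟨J, hJ⟩ := eventually_atTop.1 (hlim.eventually_lt_const (half_pos hη))
  refine ⟨K + J, fun k hk => ?_⟩
  obtain ⟨j, rfl⟩ : ∃ j, k = K + j := ⟨k - K, by omega⟩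
  rw [Real.dist_eq]
  linarith [hb j, hJ j (by omega)]

/-- One gradient step increases the projection quotient `y / σ`, quantitatively. -/
theorem quotient_step {σ σ' y y' s n b m L : ℝ} (hσ : 0 < σ) (hσ' : 0 < σ') (hy : 0 ≤ y)
    (hs : 0 ≤ s) (hn : 0 ≤ n) (hm : m ≤ L * n) (hb : |s * b| ≤ σ ^ 2 / 2)
    (hL : 2 * (y * s * L) ≤ σ ^ 2) (hy' : y' = y + s * (n + y / σ ^ 2 * b))
    (hσσ : σ' ^ 2 = σ ^ 2 + 2 * (s * b) + s ^ 2 * m) :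
    y / σ ≤ y' / σ' ∧ y * s * n ≤ 2 * σ' ^ 2 * ((y' / σ') ^ 2 - (y / σ) ^ 2) := by
  set t := s * b / σ ^ 2 with ht
  have htb : s * b = t * σ ^ 2 := by rw [ht]; field_simp
  have ht1 : -(1 / 2) ≤ t := by
    have := (abs_le.1 hb).1
    rw [htb] at this
    nlinarith [pow_pos hσ 2]
  have hyt : y' = y * (1 + t) + s * n := by rw [hy', ht]; field_simp; ring
  have hy0 : 0 ≤ y' := by
    rw [hyt]
    have : 0 ≤ 1 + t := by linarith
    positivity
  have hysn : 0 ≤ y * s * n := by positivity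
  have hX : y * s * n * σ ^ 2 / 2 ≤ y' ^ 2 * σ ^ 2 - y ^ 2 * σ' ^ 2 := by
    have e : y' ^ 2 * σ ^ 2 - y ^ 2 * σ' ^ 2 = y ^ 2 * t ^ 2 * σ ^ 2
        + 2 * (1 + t) * (y * s * n) * σ ^ 2 + σ ^ 2 * (s * n) ^ 2 - y ^ 2 * s ^ 2 * m := by
      rw [hσσ, htb, hyt]; ring
    have h1 : y ^ 2 * s ^ 2 * m ≤ y * s * n * σ ^ 2 / 2 := by
      calc y ^ 2 * s ^ 2 * m ≤ y ^ 2 * s ^ 2 * (L * n) := by gcongr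
        _ = (y * s * n) * (y * s * L) := by ring
        _ ≤ (y * s * n) * (σ ^ 2 / 2) := by gcongr; linarith
        _ = _ := by ring
    have h2 : y * s * n * σ ^ 2 ≤ 2 * (1 + t) * (y * s * n) * σ ^ 2 := by
      have : 0 ≤ y * s * n * σ ^ 2 := by positivity
      nlinarith
    have h3 : 0 ≤ y ^ 2 * t ^ 2 * σ ^ 2 := by positivity
    have h4 : 0 ≤ σ ^ 2 * (s * n) ^ 2 := by positivity
    rw [e]; linarith
  constructor
  · rw [div_le_div_iff₀ hσ hσ']
    refine le_of_sq_le_sq ?_ (by positivity)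
    have : 0 ≤ y * s * n * σ ^ 2 / 2 := by positivity
    rw [mul_pow, mul_pow]; linarith
  · have e : 2 * σ' ^ 2 * ((y' / σ') ^ 2 - (y / σ) ^ 2)
        = 2 * (y' ^ 2 * σ ^ 2 - y ^ 2 * σ' ^ 2) / σ ^ 2 := by field_simp
    rw [e, le_div_iff₀ (by positivity)]
    linarith

theorem exists_small (c : ℝ) (hc : 0 ≤ c) (d : ℝ) (hd : 0 < d) :
    ∃ δ > 0, ∀ ε N : ℝ, 0 < ε → 0 < N → ε / N < δ → ε * c ≤ d * N := by
  refine ⟨d / (c + 1), by positivity, fun ε N hε hN h => ?_⟩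
  rw [div_lt_div_iff₀ hN (by positivity)] at h
  linarith

variable {E : Type*} [NormedAddCommGroup E] [InnerProductSpace ℝ E]

/-- The energy norm `√⟪T x, x⟫`. -/
def energyNorm (T : E →L[ℝ] E) (x : E) : ℝ := √(inner ℝ (T x) x)

/-- The quotient `⟪x, T u⟫ / ‖x‖_T`. -/
def quotient (T : E →L[ℝ] E) (u x : E) : ℝ := inner ℝ x (T u) / energyNorm T x

/-- The direction `T u - (⟪x, T u⟫ / ‖x‖_T²) T x`. -/
def direction (T : E →L[ℝ] E) (u x : E) : E :=
  T u - (inner ℝ x (T u) / energyNorm T x ^ 2) • T x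

/-- A symmetric, bounded and coercive operator, with explicit constants. -/
structure Elliptic (T : E →L[ℝ] E) (l L : ℝ) : Prop where
  pos_lower : 0 < l
  pos_upper : 0 < L
  symm : ∀ x y, inner ℝ (T x) y = inner ℝ x (T y)
  lower : ∀ x, l ^ 2 * ‖x‖ ^ 2 ≤ inner ℝ (T x) x
  upper : ∀ x, ‖T x‖ ≤ L * ‖x‖

section Step

variable {T : E →L[ℝ] E} {l L : ℝ} {u x : E}

theorem Elliptic.inner_nonneg (hT : Elliptic T l L) (x : E) : 0 ≤ inner ℝ (T x) x :=
  le_trans (by positivity) (hT.lower x)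

theorem Elliptic.energyNorm_sq (hT : Elliptic T l L) (x : E) :
    energyNorm T x ^ 2 = inner ℝ (T x) x := Real.sq_sqrt (hT.inner_nonneg x)

theorem Elliptic.lower_energyNorm (hT : Elliptic T l L) (x : E) : l * ‖x‖ ≤ energyNorm T x := by
  refine Real.le_sqrt_of_sq_le ?_
  rw [mul_pow]; exact hT.lower x

theorem Elliptic.energyNorm_pos (hT : Elliptic T l L) (hx : x ≠ 0) : 0 < energyNorm T x :=
  lt_of_lt_of_le (mul_pos hT.pos_lower (norm_pos_iff.2 hx)) (hT.lower_energyNorm x)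

theorem Elliptic.inner_le (hT : Elliptic T l L) (x : E) : inner ℝ (T x) x ≤ L * ‖x‖ ^ 2 :=
  calc inner ℝ (T x) x ≤ ‖T x‖ * ‖x‖ := real_inner_le_norm _ _
    _ ≤ L * ‖x‖ * ‖x‖ := by gcongr; exact hT.upper x
    _ = _ := by ring

theorem energyNorm_nonneg (T : E →L[ℝ] E) (x : E) : 0 ≤ energyNorm T x := Real.sqrt_nonneg _

theorem energyNorm_neg (T : E →L[ℝ] E) (x : E) : energyNorm T (-x) = energyNorm T x := by
  simp [energyNorm]

theorem quotient_neg (T : E →L[ℝ] E) (u x : E) : quotient T u (-x) = -quotient T u x := by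
  simp [quotient, energyNorm_neg, neg_div]

theorem direction_neg (T : E →L[ℝ] E) (u x : E) : direction T u (-x) = direction T u x := by
  simp [direction, energyNorm_neg, neg_div]

theorem direction_eq (T : E →L[ℝ] E) (u x : E) :
    direction T u x = T (u - (inner ℝ x (T u) / energyNorm T x ^ 2) • x) := by
  simp [direction]

/-- Pythagoras in the energy inner product. -/
theorem Elliptic.inner_residual (hT : Elliptic T l L) (hx : x ≠ 0) :
    inner ℝ (T (u - (inner ℝ x (T u) / energyNorm T x ^ 2) • x))
      (u - (inner ℝ x (T u) / energyNorm T x ^ 2) • x)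
      = energyNorm T u ^ 2 - quotient T u x ^ 2 := by
  have hσ := (hT.energyNorm_pos hx).ne'
  have e1 : inner ℝ (T u) x = inner ℝ x (T u) := real_inner_comm _ _
  have e2 : inner ℝ (T x) u = inner ℝ x (T u) := hT.symm x u
  simp only [map_sub, map_smul, inner_sub_left, inner_sub_right, inner_smul_left,
    inner_smul_right, e1, e2, ← hT.energyNorm_sq, quotient]
  simp only [conj_trivial]
  field_simp
  ring

theorem Elliptic.quotient_abs_le (hT : Elliptic T l L) (hx : x ≠ 0) :
    |quotient T u x| ≤ energyNorm T u := by
  refine abs_le_of_sq_le_sq ?_ (energyNorm_nonneg T u)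
  have := hT.inner_nonneg (u - (inner ℝ x (T u) / energyNorm T x ^ 2) • x)
  rw [hT.inner_residual hx] at this
  linarith

theorem Elliptic.norm_direction_le (hT : Elliptic T l L) (hx : x ≠ 0) :
    ‖direction T u x‖ ≤ L * energyNorm T u / l := by
  have hl := hT.pos_lower
  rw [direction_eq]
  refine (hT.upper _).trans ?_
  rw [mul_div_assoc]
  refine mul_le_mul_of_nonneg_left ?_ hT.pos_upper.le
  rw [le_div_iff₀ hl, mul_comm]
  refine (hT.lower_energyNorm _).trans (Real.sqrt_le_sqrt ?_ |>.trans_eq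
    (Real.sqrt_sq (energyNorm_nonneg T u)))
  rw [hT.inner_residual hx]
  linarith [sq_nonneg (quotient T u x)]

theorem Elliptic.inner_direction (hT : Elliptic T l L) (hx : x ≠ 0) :
    inner ℝ x (direction T u x) = 0 := by
  have hσ := (hT.energyNorm_pos hx).ne'
  rw [direction, inner_sub_right, inner_smul_right, ← hT.symm x x, ← hT.energyNorm_sq]
  field_simp
  ring

theorem inner_grad_direction :
    inner ℝ (direction T u x) (T u) = ‖direction T u x‖ ^ 2
      + inner ℝ x (T u) / energyNorm T x ^ 2 * inner ℝ (T x) (direction T u x) := by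
  have e : T u = direction T u x + (inner ℝ x (T u) / energyNorm T x ^ 2) • T x := by
    simp [direction]
  rw [← real_inner_self_eq_norm_sq]
  conv_lhs => rw [e]
  rw [inner_add_right, inner_smul_right, real_inner_comm (direction T u x) (T x)]

theorem Elliptic.energyNorm_sq_step (hT : Elliptic T l L) (s : ℝ) (v : E) :
    energyNorm T (x + s • v) ^ 2
      = energyNorm T x ^ 2 + 2 * (s * inner ℝ (T x) v) + s ^ 2 * inner ℝ (T v) v := by
  have e : inner ℝ (T v) x = inner ℝ (T x) v := by rw [hT.symm, real_inner_comm]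
  simp only [hT.energyNorm_sq, map_add, map_smul, inner_add_left, inner_add_right,
    inner_smul_left, inner_smul_right, e, conj_trivial]
  ring

/-- The step size `ε` is small relative to `N = ‖x‖²`. -/
structure SmallStep (T : E →L[ℝ] E) (u : E) (l L A ε N : ℝ) : Prop where
  cross : ε * (A * L * (L * energyNorm T u / l) / l) ≤ l ^ 2 / 2 * N
  curv : ε * (2 * A * energyNorm T u * L) ≤ l ^ 2 * N
  incr : ε * (A * (L * energyNorm T u / l) / l) ≤ 1 * N
  swap : ε * (‖T u‖ * (L * energyNorm T u / l)) ≤ l ^ 2 / 2 * N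

theorem SmallStep.mono {A ε N N' : ℝ} (hl : 0 < l) (h : SmallStep T u l L A ε N) (hN : N ≤ N') :
    SmallStep T u l L A ε N' where
  cross := h.cross.trans (by gcongr)
  curv := h.curv.trans (by gcongr)
  incr := h.incr.trans (by gcongr)
  swap := h.swap.trans (by gcongr)

theorem Elliptic.exists_smallStep (hT : Elliptic T l L) (u : E) {A : ℝ} (hA : 0 ≤ A) :
    ∃ δ > 0, ∀ ε N : ℝ, 0 < ε → 0 < N → ε / N < δ → SmallStep T u l L A ε N := by
  have hl := hT.pos_lower
  have hL := hT.pos_upper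
  have hM := energyNorm_nonneg T u
  obtain ⟨δ₁, p₁, h₁⟩ := exists_small (A * L * (L * energyNorm T u / l) / l) (by positivity)
    (l ^ 2 / 2) (by positivity)
  obtain ⟨δ₂, p₂, h₂⟩ := exists_small (2 * A * energyNorm T u * L) (by positivity)
    (l ^ 2) (by positivity)
  obtain ⟨δ₃, p₃, h₃⟩ := exists_small (A * (L * energyNorm T u / l) / l) (by positivity)
    1 (by positivity)
  obtain ⟨δ₄, p₄, h₄⟩ := exists_small (‖T u‖ * (L * energyNorm T u / l)) (by positivity)
    (l ^ 2 / 2) (by positivity)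
  refine ⟨min (min δ₁ δ₂) (min δ₃ δ₄), by positivity, fun ε N hε hN h => ?_⟩
  simp only [lt_min_iff] at h
  exact ⟨h₁ ε N hε hN h.1.1, h₂ ε N hε hN h.1.2, h₃ ε N hε hN h.2.1, h₄ ε N hε hN h.2.2⟩

variable {A ε a : ℝ}

/-- The update of the weight vector. -/
def stepW (T : E →L[ℝ] E) (u : E) (ε a : ℝ) (x : E) : E :=
  x + (ε * (a / energyNorm T x)) • direction T u x

theorem stepW_neg : stepW T u ε (-a) (-x) = -stepW T u ε a x := by
  simp [stepW, direction_neg, energyNorm_neg, neg_div]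
  abel

theorem Elliptic.norm_sq_stepW (hT : Elliptic T l L) (hx : x ≠ 0) :
    ‖stepW T u ε a x‖ ^ 2 = ‖x‖ ^ 2 + ‖stepW T u ε a x - x‖ ^ 2 := by
  rw [stepW, add_sub_cancel_left, norm_add_sq_real, inner_smul_right, hT.inner_direction hx]
  ring

theorem Elliptic.norm_stepW_sub_le (hT : Elliptic T l L) (hx : x ≠ 0) (hε : 0 < ε) :
    ‖stepW T u ε a x - x‖ ≤ ε * (L * energyNorm T u / l) / (l * ‖x‖) * |a| := by
  have hl := hT.pos_lower
  have hL := hT.pos_upper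
  have hσ := hT.energyNorm_pos hx
  have hx' : 0 < ‖x‖ := norm_pos_iff.2 hx
  have hM := energyNorm_nonneg T u
  rw [stepW, add_sub_cancel_left, norm_smul, Real.norm_eq_abs, abs_mul, abs_div, abs_of_pos hε,
    abs_of_pos hσ]
  calc ε * (|a| / energyNorm T x) * ‖direction T u x‖
      ≤ ε * (|a| / (l * ‖x‖)) * (L * energyNorm T u / l) := by
        gcongr
        · exact hT.lower_energyNorm x
        · exact hT.norm_direction_le hx
    _ = _ := by ring

theorem Elliptic.norm_stepW_sub_le_norm (hT : Elliptic T l L) (hx : x ≠ 0) (hε : 0 < ε)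
    (ha : |a| ≤ A) (hs : SmallStep T u l L A ε (‖x‖ ^ 2)) : ‖stepW T u ε a x - x‖ ≤ ‖x‖ := by
  have hl := hT.pos_lower
  have hL := hT.pos_upper
  have hx' : 0 < ‖x‖ := norm_pos_iff.2 hx
  have hM := energyNorm_nonneg T u
  refine (hT.norm_stepW_sub_le hx hε).trans ?_
  calc ε * (L * energyNorm T u / l) / (l * ‖x‖) * |a|
      ≤ ε * (L * energyNorm T u / l) / (l * ‖x‖) * A := by gcongr
    _ = ε * (A * (L * energyNorm T u / l) / l) / ‖x‖ := by field_simp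
    _ ≤ 1 * ‖x‖ ^ 2 / ‖x‖ := by gcongr ?_ / _; exact hs.incr
    _ = ‖x‖ := by field_simp

theorem Elliptic.stepW_ne_zero (hT : Elliptic T l L) (hx : x ≠ 0) : stepW T u ε a x ≠ 0 := by
  intro h
  have e := hT.norm_sq_stepW (u := u) (ε := ε) (a := a) hx
  have : 0 < ‖x‖ := norm_pos_iff.2 hx
  rw [h] at e
  simp at e
  nlinarith [sq_nonneg ‖x‖]

theorem inner_stepW : inner ℝ (stepW T u ε a x) (T u) = inner ℝ x (T u)
    + (ε * (a / energyNorm T x)) * inner ℝ (direction T u x) (T u) := by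
  rw [stepW, inner_add_left, inner_smul_left, conj_trivial]

/-- If the quotient changes sign in a step, then it is small relative to `a`. -/
theorem Elliptic.quotient_swap (hT : Elliptic T l L) (hx : x ≠ 0) (hε : 0 < ε)
    (hs : SmallStep T u l L A ε (‖x‖ ^ 2))
    (h : quotient T u x * quotient T u (stepW T u ε a x) ≤ 0) : |quotient T u x| ≤ |a| / 2 := by
  have hl := hT.pos_lower
  have hL := hT.pos_upper
  have hσ := hT.energyNorm_pos hx
  have hσ' := hT.energyNorm_pos (hT.stepW_ne_zero (u := u) (ε := ε) (a := a) hx)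
  have hM := energyNorm_nonneg T u
  set y := inner ℝ x (T u) with hy
  set y' := inner ℝ (stepW T u ε a x) (T u) with hy'
  have hyy : y * y' ≤ 0 := by
    have e : y * y' = quotient T u x * quotient T u (stepW T u ε a x)
        * (energyNorm T x * energyNorm T (stepW T u ε a x)) := by
      rw [quotient, quotient, ← hy, ← hy']; field_simp
    rw [e]; exact mul_nonpos_of_nonpos_of_nonneg h (by positivity)
  have h1 : |y| ≤ |y' - y| := by
    refine sq_le_sq.1 ?_
    nlinarith [sq_nonneg y']
  have h2 : |y' - y| ≤ ε * (|a| / energyNorm T x) * (‖T u‖ * (L * energyNorm T u / l)) := by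
    rw [hy', inner_stepW, add_sub_cancel_left, abs_mul, abs_mul, abs_div, abs_of_pos hε,
      abs_of_pos hσ]
    gcongr
    calc _ ≤ ‖direction T u x‖ * ‖T u‖ := abs_real_inner_le_norm _ _
      _ ≤ (L * energyNorm T u / l) * ‖T u‖ := by gcongr; exact hT.norm_direction_le hx
      _ = _ := mul_comm _ _
  have h3 : l ^ 2 * ‖x‖ ^ 2 ≤ energyNorm T x ^ 2 := (hT.lower x).trans_eq (hT.energyNorm_sq x).symm
  rw [quotient, abs_div, abs_of_pos hσ, div_le_iff₀ hσ]
  refine (h1.trans h2).trans ?_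
  calc _ = ε * (‖T u‖ * (L * energyNorm T u / l)) * (|a| / energyNorm T x) := by ring
    _ ≤ energyNorm T x ^ 2 / 2 * (|a| / energyNorm T x) := by
      gcongr; linarith [hs.swap]
    _ = _ := by field_simp

/-- In the same-sign regime a step increases the quotient, and the squared displacement is
controlled by the increase. -/
theorem Elliptic.quotient_ascent (hT : Elliptic T l L) (hx : x ≠ 0) (hε : 0 < ε)
    (haA : |a| ≤ A) (hs : SmallStep T u l L A ε (‖x‖ ^ 2)) (ha : 0 ≤ a)
    (hq : 0 ≤ quotient T u x) :
    quotient T u x ≤ quotient T u (stepW T u ε a x) ∧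
      quotient T u x * ‖stepW T u ε a x - x‖ ^ 2
        ≤ 4 * ε * (L / l ^ 2) * a * (quotient T u (stepW T u ε a x) ^ 2 - quotient T u x ^ 2) := by
  have hl := hT.pos_lower
  have hL := hT.pos_upper
  have hx' : 0 < ‖x‖ := norm_pos_iff.2 hx
  have hσ := hT.energyNorm_pos hx
  have hne := hT.stepW_ne_zero (u := u) (ε := ε) (a := a) hx
  have hσ' := hT.energyNorm_pos hne
  have hM := energyNorm_nonneg T u
  have hA : 0 ≤ A := (abs_nonneg a).trans haA
  have haA' : a ≤ A := (le_abs_self a).trans haA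
  have hlow : l ^ 2 * ‖x‖ ^ 2 ≤ energyNorm T x ^ 2 :=
    (hT.lower x).trans_eq (hT.energyNorm_sq x).symm
  have hqM := (le_abs_self _).trans (hT.quotient_abs_le (u := u) hx)
  have hstep := hT.norm_stepW_sub_le_norm hx hε haA hs
  have hnorm := hT.norm_sq_stepW (u := u) (ε := ε) (a := a) hx
  set σ := energyNorm T x with hσd
  set σ' := energyNorm T (stepW T u ε a x) with hσd'
  set v := direction T u x with hv
  set s := ε * (a / σ) with hsd
  have hs0 : 0 ≤ s := by positivity
  have hy : 0 ≤ inner ℝ x (T u) := by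
    have : inner ℝ x (T u) = quotient T u x * σ := by
      rw [quotient, ← hσd]; field_simp
    rw [this]; positivity
  have hys : inner ℝ x (T u) * s = ε * a * quotient T u x := by
    rw [hsd, quotient]; ring
  have hdisp : ‖stepW T u ε a x - x‖ ^ 2 = s ^ 2 * ‖v‖ ^ 2 := by
    rw [stepW, add_sub_cancel_left, norm_smul, mul_pow, Real.norm_eq_abs, sq_abs]
  have key := quotient_step (σ := σ) (σ' := σ') (y := inner ℝ x (T u))
    (y' := inner ℝ (stepW T u ε a x) (T u)) (s := s) (n := ‖v‖ ^ 2) (b := inner ℝ (T x) v)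
    (m := inner ℝ (T v) v) (L := L) hσ hσ' hy hs0 (by positivity) (hT.inner_le v) ?_ ?_ ?_ ?_
  · refine ⟨key.1, ?_⟩
    have hσσ : σ' ^ 2 ≤ 2 * (L / l ^ 2) * σ ^ 2 := by
      calc σ' ^ 2 = inner ℝ (T (stepW T u ε a x)) (stepW T u ε a x) := hT.energyNorm_sq _
        _ ≤ L * ‖stepW T u ε a x‖ ^ 2 := hT.inner_le _
        _ = L * (‖x‖ ^ 2 + ‖stepW T u ε a x - x‖ ^ 2) := by rw [hnorm]
        _ ≤ L * (‖x‖ ^ 2 + ‖x‖ ^ 2) := by gcongr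
        _ = 2 * (L / l ^ 2) * (l ^ 2 * ‖x‖ ^ 2) := by field_simp; ring
        _ ≤ _ := by gcongr
    have hinc : 0 ≤ quotient T u (stepW T u ε a x) ^ 2 - quotient T u x ^ 2 := by
      have : quotient T u x ^ 2 ≤ quotient T u (stepW T u ε a x) ^ 2 :=
        pow_le_pow_left₀ hq key.1 2
      linarith
    have k2 : inner ℝ x (T u) * s * ‖v‖ ^ 2 ≤ 2 * σ' ^ 2 *
      (quotient T u (stepW T u ε a x) ^ 2 - quotient T u x ^ 2) := key.2
    calc quotient T u x * ‖stepW T u ε a x - x‖ ^ 2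
        = (inner ℝ x (T u) * s * ‖v‖ ^ 2) * (ε * a / σ ^ 2) := by
          rw [hdisp, quotient, ← hσd, hsd]; field_simp
      _ ≤ (2 * (2 * (L / l ^ 2) * σ ^ 2) *
          (quotient T u (stepW T u ε a x) ^ 2 - quotient T u x ^ 2)) * (ε * a / σ ^ 2) := by
          refine mul_le_mul_of_nonneg_right (k2.trans ?_) (by positivity)
          gcongr
      _ = _ := by field_simp; ring
  · rw [abs_mul, abs_of_nonneg hs0]
    calc s * |inner ℝ (T x) v| ≤ s * (‖T x‖ * ‖v‖) := by
          gcongr; exact abs_real_inner_le_norm _ _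
      _ ≤ ε * (A / (l * ‖x‖)) * (L * ‖x‖ * (L * energyNorm T u / l)) := by
          rw [hsd]
          gcongr
          · exact hT.lower_energyNorm x
          · exact hT.upper x
          · exact hT.norm_direction_le hx
      _ = ε * (A * L * (L * energyNorm T u / l) / l) := by field_simp
      _ ≤ l ^ 2 / 2 * ‖x‖ ^ 2 := hs.cross
      _ ≤ _ := by linarith
  · rw [hys]
    calc 2 * (ε * a * quotient T u x * L) ≤ 2 * (ε * A * energyNorm T u * L) := by gcongr
      _ = ε * (2 * A * energyNorm T u * L) := by ring
      _ ≤ _ := hs.curv.trans hlow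
  · rw [inner_stepW, inner_grad_direction]
  · exact hT.energyNorm_sq_step _ _

end Step

theorem continuous_energyNorm (T : E →L[ℝ] E) : Continuous (energyNorm T) := by
  unfold energyNorm; fun_prop

theorem Elliptic.tendsto_quotient {T : E →L[ℝ] E} {l L : ℝ} (hT : Elliptic T l L) (u : E)
    {w : ℕ → E} {x : E} (hx : x ≠ 0) (hw : Tendsto w atTop (𝓝 x)) :
    Tendsto (fun k => quotient T u (w k)) atTop (𝓝 (quotient T u x)) :=
  (hw.inner tendsto_const_nhds).div (((continuous_energyNorm T).tendsto x).comp hw)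
    (ne_of_gt (hT.energyNorm_pos hx))

/-- A run of BNGD with small step size, together with the a priori bound on `a`. -/
structure Run (T : E →L[ℝ] E) (u : E) (l L A εa ε : ℝ) (a : ℕ → ℝ) (w : ℕ → E) : Prop where
  elliptic : Elliptic T l L
  rate_pos : 0 < εa
  rate_le : εa ≤ 1
  step_pos : 0 < ε
  init_ne : w 0 ≠ 0
  init_le : |a 0| ≤ A
  energy_le : energyNorm T u ≤ A
  small : SmallStep T u l L A ε (‖w 0‖ ^ 2)
  step_a : ∀ k, a (k + 1) = a k + εa * (quotient T u (w k) - a k)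
  step_w : ∀ k, w (k + 1) = stepW T u ε (a k) (w k)

namespace Run

variable {T : E →L[ℝ] E} {u : E} {l L A εa ε : ℝ} {a : ℕ → ℝ} {w : ℕ → E}

theorem neg (h : Run T u l L A εa ε a w) :
    Run T u l L A εa ε (fun k => -a k) (fun k => -w k) where
  elliptic := h.elliptic
  rate_pos := h.rate_pos
  rate_le := h.rate_le
  step_pos := h.step_pos
  init_ne := neg_ne_zero.2 h.init_ne
  init_le := by simpa using h.init_le
  energy_le := h.energy_le
  small := by simpa using h.small
  step_a k := by rw [h.step_a, quotient_neg]; ring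
  step_w k := by rw [h.step_w, stepW_neg]

theorem ne_zero (h : Run T u l L A εa ε a w) (k : ℕ) : w k ≠ 0 := by
  induction k with
  | zero => exact h.init_ne
  | succ k ih => rw [h.step_w]; exact h.elliptic.stepW_ne_zero ih

theorem norm_sq_succ (h : Run T u l L A εa ε a w) (k : ℕ) :
    ‖w (k + 1)‖ ^ 2 = ‖w k‖ ^ 2 + ‖w (k + 1) - w k‖ ^ 2 := by
  rw [h.step_w]; exact h.elliptic.norm_sq_stepW (h.ne_zero k)

theorem monotone_norm (h : Run T u l L A εa ε a w) : Monotone fun k => ‖w k‖ :=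
  monotone_nat_of_le_succ fun k => by
    refine le_of_sq_le_sq ?_ (norm_nonneg _)
    rw [h.norm_sq_succ k]
    exact le_add_of_nonneg_right (sq_nonneg _)

theorem small_at (h : Run T u l L A εa ε a w) (k : ℕ) : SmallStep T u l L A ε (‖w k‖ ^ 2) :=
  h.small.mono h.elliptic.pos_lower
    (pow_le_pow_left₀ (norm_nonneg _) (h.monotone_norm (Nat.zero_le k)) 2)

theorem abs_le (h : Run T u l L A εa ε a w) (k : ℕ) : |a k| ≤ A := by
  induction k with
  | zero => exact h.init_le
  | succ k ih =>
    have hq := (h.elliptic.quotient_abs_le (u := u) (h.ne_zero k)).trans h.energy_le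
    have h0 := h.rate_pos
    have h1 : 0 ≤ 1 - εa := sub_nonneg.2 h.rate_le
    calc |a (k + 1)| = |(1 - εa) * a k + εa * quotient T u (w k)| := by rw [h.step_a]; ring_nf
      _ ≤ (1 - εa) * |a k| + εa * |quotient T u (w k)| := by
        refine (abs_add_le _ _).trans_eq ?_
        rw [abs_mul, abs_mul, abs_of_nonneg h1, abs_of_pos h0]
      _ ≤ (1 - εa) * A + εa * A := by gcongr
      _ = A := by ring

theorem ascent (h : Run T u l L A εa ε a w) (k : ℕ) (ha : 0 ≤ a k)
    (hq : 0 ≤ quotient T u (w k)) :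
    quotient T u (w k) ≤ quotient T u (w (k + 1)) ∧
      quotient T u (w k) * ‖w (k + 1) - w k‖ ^ 2 ≤ 4 * ε * (L / l ^ 2) * a k *
        (quotient T u (w (k + 1)) ^ 2 - quotient T u (w k) ^ 2) := by
  rw [h.step_w]
  exact h.elliptic.quotient_ascent (h.ne_zero k) h.step_pos (h.abs_le k) (h.small_at k) ha hq

theorem ne_zero_of_tendsto (h : Run T u l L A εa ε a w) {x : E} (hx : Tendsto w atTop (𝓝 x)) :
    x ≠ 0 :=
  norm_pos_iff.1 <| (norm_pos_iff.2 h.init_ne).trans_le <|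
    ge_of_tendsto' hx.norm fun k => h.monotone_norm (Nat.zero_le k)

/-- Geometric decay of `a` forces convergence to a saddle point. -/
theorem saddle [CompleteSpace E] (h : Run T u l L A εa ε a w) {ρ : ℝ} (h0 : 0 ≤ ρ) (h1 : ρ < 1)
    {K : ℕ} (hK : ∀ k ≥ K, |a (k + 1)| ≤ ρ * |a k|) :
    ∃ x, Tendsto a atTop (𝓝 0) ∧ Tendsto w atTop (𝓝 x) ∧ inner ℝ x (T u) = 0 := by
  have hl := h.elliptic.pos_lower
  have hL := h.elliptic.pos_upper
  have hε := h.step_pos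
  have hM := energyNorm_nonneg T u
  have hgeo : ∀ j, |a (j + K)| ≤ |a K| * ρ ^ j := by
    intro j
    induction j with
    | zero => simp
    | succ j ih =>
      calc |a (j + 1 + K)| = |a (j + K + 1)| := by rw [add_right_comm]
        _ ≤ ρ * |a (j + K)| := hK _ (by omega)
        _ ≤ ρ * (|a K| * ρ ^ j) := by gcongr
        _ = _ := by ring
  have ha : Tendsto a atTop (𝓝 0) := by
    rw [← tendsto_add_atTop_iff_nat K]
    refine squeeze_zero_norm hgeo ?_
    simpa using (tendsto_pow_atTop_nhds_zero_of_lt_one h0 h1).const_mul |a K|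
  have hw0 : 0 < ‖w 0‖ := norm_pos_iff.2 h.init_ne
  have hdist : ∀ j, dist (w (j + K)) (w (j + 1 + K)) ≤
      (ε * (L * energyNorm T u / l) / (l * ‖w 0‖) * |a K|) * ρ ^ j := by
    intro j
    rw [dist_comm, dist_eq_norm, add_right_comm, h.step_w]
    refine (h.elliptic.norm_stepW_sub_le (h.ne_zero _) hε).trans ?_
    rw [mul_assoc _ |a K|]
    gcongr
    · exact h.monotone_norm (Nat.zero_le _)
    · exact hgeo j
  obtain ⟨x, hx⟩ := cauchySeq_tendsto_of_complete
    (cauchySeq_of_le_geometric (f := fun j => w (j + K)) ρ _ h1 hdist)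
  rw [tendsto_add_atTop_iff_nat K] at hx
  refine ⟨x, ha, hx, ?_⟩
  have hxne := h.ne_zero_of_tendsto hx
  have hq := h.elliptic.tendsto_quotient u hxne hx
  have h2 : Tendsto (fun k => a (k + 1)) atTop (𝓝 (0 + εa * (quotient T u x - 0))) := by
    simp only [h.step_a]
    exact ha.add ((hq.sub ha).const_mul εa)
  have h3 := tendsto_nhds_unique h2 ((tendsto_add_atTop_iff_nat 1).2 ha)
  simpa [(h.elliptic.energyNorm_pos hxne).ne', h.rate_pos.ne', quotient] using h3

/-- In the same-sign regime the run converges to a global minimizer. -/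
theorem minimizer (h : Run T u l L A εa ε a w) {K : ℕ} (hqK : 0 < quotient T u (w K))
    (hK : ∀ k ≥ K, 0 ≤ a k ∧ quotient T u (w K) ≤ quotient T u (w k)) :
    ∃ c : ℝ, c ≠ 0 ∧ Tendsto a atTop (𝓝 (quotient T u (c • u))) ∧
      Tendsto w atTop (𝓝 (c • u)) := by
  have hl := h.elliptic.pos_lower
  have hL := h.elliptic.pos_upper
  have hε := h.step_pos
  have hasc := fun k (hk : k ≥ K) => h.ascent k (hK k hk).1 (hqK.le.trans (hK k hk).2)
  have hqle := fun k => (le_abs_self _).trans (h.elliptic.quotient_abs_le (u := u) (h.ne_zero k))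
  have hA : 0 ≤ A := (abs_nonneg _).trans h.init_le
  -- convergence of the quotient and of `a`
  obtain ⟨q, hq⟩ : ∃ q, Tendsto (fun k => quotient T u (w k)) atTop (𝓝 q) := by
    have hmono : Monotone fun j => quotient T u (w (j + K)) :=
      monotone_nat_of_le_succ fun j => by
        rw [add_right_comm]; exact (hasc (j + K) (by omega)).1
    refine ⟨_, (tendsto_add_atTop_iff_nat K).1 (tendsto_atTop_ciSup hmono ?_)⟩
    exact ⟨energyNorm T u, by rintro _ ⟨j, rfl⟩; exact hqle _⟩
  have hq0 : 0 < q := hqK.trans_le (ge_of_tendsto hq (eventually_atTop.2 ⟨K, fun k hk =>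
    (hK k hk).2⟩))
  have ha := tendsto_average h.rate_pos h.rate_le h.step_a hq
  -- boundedness of the norms
  set C := 4 * ε * (L / l ^ 2) * A / quotient T u (w K) with hC
  have hC0 : 0 ≤ C := by positivity
  have hdisp : ∀ k ≥ K, ‖w (k + 1) - w k‖ ^ 2
      ≤ C * (quotient T u (w (k + 1)) ^ 2 - quotient T u (w k) ^ 2) := by
    intro k hk
    have hak := (le_abs_self _).trans (h.abs_le k)
    have hinc : 0 ≤ quotient T u (w (k + 1)) ^ 2 - quotient T u (w k) ^ 2 :=
      sub_nonneg.2 (pow_le_pow_left₀ (hqK.le.trans (hK k hk).2) (hasc k hk).1 2)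
    rw [hC, div_mul_eq_mul_div, le_div_iff₀ hqK, mul_comm]
    calc quotient T u (w K) * ‖w (k + 1) - w k‖ ^ 2
        ≤ quotient T u (w k) * ‖w (k + 1) - w k‖ ^ 2 := by gcongr; exact (hK k hk).2
      _ ≤ _ := (hasc k hk).2
      _ ≤ _ := by gcongr
  have hdecr : ∀ k ≥ K, ‖w k‖ ^ 2 - C * quotient T u (w k) ^ 2
      ≤ ‖w K‖ ^ 2 - C * quotient T u (w K) ^ 2 := by
    intro k hk
    induction k, hk using Nat.le_induction with
    | base => exact le_rfl
    | succ k hk ih => rw [h.norm_sq_succ]; linarith [hdisp k hk]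
  obtain ⟨N, hN⟩ : ∃ N, Tendsto (fun k => ‖w k‖) atTop (𝓝 N) := by
    refine ⟨_, tendsto_atTop_ciSup h.monotone_norm
      ⟨√(‖w K‖ ^ 2 + C * energyNorm T u ^ 2), ?_⟩⟩
    rintro _ ⟨k, rfl⟩
    refine (h.monotone_norm (le_max_left k K)).trans (Real.le_sqrt_of_sq_le ?_)
    have h1 := hdecr (max k K) (le_max_right k K)
    have h2 : C * quotient T u (w (max k K)) ^ 2 ≤ C * energyNorm T u ^ 2 :=
      mul_le_mul_of_nonneg_left (sq_le_sq' (by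
        linarith [(_root_.abs_le.1 (h.elliptic.quotient_abs_le (u := u) (h.ne_zero (max k K)))).1])
        (hqle _)) hC0
    have h3 : 0 ≤ C * quotient T u (w K) ^ 2 := by positivity
    linarith
  have hN0 : 0 < N := (norm_pos_iff.2 h.init_ne).trans_le
    (ge_of_tendsto' hN fun k => h.monotone_norm (Nat.zero_le k))
  -- the residual tends to zero
  set e : ℕ → E := fun k => u - (inner ℝ (w k) (T u) / energyNorm T (w k) ^ 2) • w k with he
  have hincr : Tendsto (fun k => ‖w (k + 1) - w k‖) atTop (𝓝 0) := by
    have h1 : Tendsto (fun k => ‖w (k + 1) - w k‖ ^ 2) atTop (𝓝 0) := by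
      have h2 : (fun k => ‖w (k + 1) - w k‖ ^ 2) = fun k => ‖w (k + 1)‖ ^ 2 - ‖w k‖ ^ 2 := by
        ext k; rw [h.norm_sq_succ k]; ring
      rw [h2]
      simpa using (((tendsto_add_atTop_iff_nat 1).2 hN).pow 2).sub (hN.pow 2)
    simpa using h1.sqrt
  have he0 : Tendsto e atTop (𝓝 0) := by
    have hbound : ∀ᶠ k in atTop, ‖e k‖ ≤
        (L * N / l / (l ^ 2 * ε)) * (‖w (k + 1) - w k‖ * (a k)⁻¹) := by
      filter_upwards [ha.eventually_const_lt hq0] with k hak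
      have hwk := h.ne_zero k
      have hσ := h.elliptic.energyNorm_pos hwk
      have hσN : energyNorm T (w k) ≤ L * N / l := by
        have hkN : ‖w k‖ ≤ N := h.monotone_norm.ge_of_tendsto hN k
        have h1 : energyNorm T (w k) * energyNorm T (w k) ≤ L * N / l * energyNorm T (w k) := by
          calc energyNorm T (w k) * energyNorm T (w k) = energyNorm T (w k) ^ 2 := by ring
            _ ≤ L * ‖w k‖ ^ 2 := (h.elliptic.energyNorm_sq _).trans_le (h.elliptic.inner_le _)
            _ = L * ‖w k‖ / l * (l * ‖w k‖) := by field_simp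
            _ ≤ L * N / l * energyNorm T (w k) := by
              gcongr; exact h.elliptic.lower_energyNorm _
        exact le_of_mul_le_mul_right h1 hσ
      have hdir : l ^ 2 * ‖e k‖ ≤ ‖T (e k)‖ := by
        rcases eq_or_ne (e k) 0 with h0 | h0
        · simp [h0]
        · refine le_of_mul_le_mul_right ?_ (norm_pos_iff.2 h0)
          calc _ = l ^ 2 * ‖e k‖ ^ 2 := by ring
            _ ≤ _ := h.elliptic.lower _
            _ ≤ _ := real_inner_le_norm _ _
      have hstep : ‖w (k + 1) - w k‖ = ε * (a k / energyNorm T (w k)) * ‖T (e k)‖ := by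
        rw [h.step_w, stepW, add_sub_cancel_left, norm_smul, direction_eq, Real.norm_eq_abs,
          abs_of_nonneg (by positivity)]
      calc ‖e k‖ = l ^ 2 * ‖e k‖ / l ^ 2 := by field_simp
        _ ≤ ‖T (e k)‖ / l ^ 2 := by gcongr
        _ = energyNorm T (w k) / (l ^ 2 * ε) * (‖w (k + 1) - w k‖ * (a k)⁻¹) := by
          rw [hstep]; field_simp
        _ ≤ L * N / l / (l ^ 2 * ε) * (‖w (k + 1) - w k‖ * (a k)⁻¹) := by gcongr
    refine squeeze_zero_norm' hbound ?_
    simpa using (hincr.mul (ha.inv₀ hq0.ne')).const_mul (L * N / l / (l ^ 2 * ε))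
  -- reconstruct `w` from the residual
  have hu : 0 < ‖u‖ := by
    rw [norm_pos_iff]
    rintro rfl
    simp [quotient] at hqK
  have hue : Tendsto (fun k => u - e k) atTop (𝓝 u) := by
    simpa using (tendsto_const_nhds (x := u)).sub he0
  have hw : Tendsto w atTop (𝓝 ((N / ‖u‖) • u)) := by
    refine Tendsto.congr' ?_ ((hN.div hue.norm hu.ne').smul hue)
    filter_upwards [eventually_ge_atTop K] with k hk
    have hwk := norm_pos_iff.2 (h.ne_zero k)
    have hσ := h.elliptic.energyNorm_pos (h.ne_zero k)
    have hqk : 0 < quotient T u (w k) := hqK.trans_le (hK k hk).2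
    have hr : u - e k = (quotient T u (w k) / energyNorm T (w k)) • w k := by
      simp only [he, sub_sub_cancel, quotient]
      congr 1; field_simp
    rw [Pi.div_apply, hr, norm_smul, Real.norm_eq_abs, abs_of_pos (by positivity), smul_smul]
    rw [show ‖w k‖ / (quotient T u (w k) / energyNorm T (w k) * ‖w k‖)
      * (quotient T u (w k) / energyNorm T (w k)) = 1 by field_simp, one_smul]
  refine ⟨N / ‖u‖, by positivity, ?_, hw⟩
  have := tendsto_nhds_unique hq (h.elliptic.tendsto_quotient u (h.ne_zero_of_tendsto hw) hw)
  rwa [← this]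

/-- Every run converges to a global minimizer or to a saddle point. -/
theorem converges [CompleteSpace E] (h : Run T u l L A εa ε a w) :
    ∃ (s : ℝ) (x : E), Tendsto a atTop (𝓝 s) ∧ Tendsto w atTop (𝓝 x) ∧
      ((∃ c : ℝ, c ≠ 0 ∧ x = c • u ∧ s = quotient T u x) ∨ (s = 0 ∧ inner ℝ x (T u) = 0)) := by
  have hdesc : ∀ k, a k ≤ 0 → quotient T u (w k) ≤ 0 →
      quotient T u (w (k + 1)) ≤ quotient T u (w k) := fun k ha hq => by
    have := (h.neg.ascent k (neg_nonneg.2 ha) (by rw [quotient_neg]; linarith)).1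
    rw [quotient_neg, quotient_neg] at this
    linarith
  rcases sign_trichotomy h.rate_pos h.rate_le h.step_a
    (fun k hk => by
      rw [h.step_w] at hk
      exact h.elliptic.quotient_swap (h.ne_zero k) h.step_pos (h.small_at k) hk)
    (fun k ha hq => (h.ascent k ha hq).1) hdesc with
    ⟨ρ, h0, h1, K, hK⟩ | ⟨K, hqK, hK⟩ | ⟨K, hqK, hK⟩
  · obtain ⟨x, ha, hx, hxu⟩ := h.saddle h0 h1 hK
    exact ⟨0, x, ha, hx, Or.inr ⟨rfl, hxu⟩⟩
  · obtain ⟨c, hc, ha, hw⟩ := h.minimizer hqK hK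
    exact ⟨_, _, ha, hw, Or.inl ⟨c, hc, rfl, rfl⟩⟩
  · obtain ⟨c, hc, ha, hw⟩ := h.neg.minimizer (K := K) (by rw [quotient_neg]; linarith)
      (fun k hk => by
        rw [quotient_neg, quotient_neg]
        exact ⟨by linarith [(hK k hk).1], by linarith [(hK k hk).2]⟩)
    refine ⟨-quotient T u (c • u), -(c • u), by simpa using ha.neg, by simpa using hw.neg,
      Or.inl ⟨-c, neg_ne_zero.2 hc, (neg_smul c u).symm, (quotient_neg T u _).symm⟩⟩

end Run

end BNGD

namespace BNGD

/-- A positive definite matrix is elliptic as an operator on Euclidean space. -/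
theorem exists_elliptic {d : ℕ} {H : Matrix (Fin d) (Fin d) ℝ} (hH : H.PosDef) (hd : 0 < d) :
    ∃ l L : ℝ, Elliptic (toEuclideanCLM (n := Fin d) (𝕜 := ℝ) H) l L := by
  set T := toEuclideanCLM (n := Fin d) (𝕜 := ℝ) H with hT
  have : NeZero d := ⟨hd.ne'⟩
  have hpos : ∀ x, x ≠ 0 → 0 < inner ℝ (T x) x := fun x hx => by
    have := hH.dotProduct_mulVec_pos (x := x.ofLp) (by simpa using hx)
    rw [EuclideanSpace.inner_eq_star_dotProduct, hT, ofLp_toEuclideanCLM]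
    simpa using this
  obtain ⟨z, hz, hmin⟩ := (isCompact_sphere (0 : EuclideanSpace ℝ (Fin d)) 1).exists_isMinOn
    (NormedSpace.sphere_nonempty.2 zero_le_one)
    (f := fun x => inner ℝ (T x) x) (by fun_prop)
  have hz0 : z ≠ 0 := by rintro rfl; simp at hz
  have hc := hpos z hz0
  refine ⟨√(inner ℝ (T z) z), ‖T‖ + 1, Real.sqrt_pos.2 hc, by positivity, fun x y => ?_,
    fun x => ?_, fun x => ?_⟩
  · rw [EuclideanSpace.inner_eq_star_dotProduct, EuclideanSpace.inner_eq_star_dotProduct, hT,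
      ofLp_toEuclideanCLM, ofLp_toEuclideanCLM]
    have hs : Hᵀ = H := by simpa using hH.isHermitian.eq
    simp only [star_trivial]
    rw [dotProduct_mulVec, ← mulVec_transpose, hs]
  · rw [Real.sq_sqrt hc.le]
    rcases eq_or_ne x 0 with rfl | hx
    · simp
    · have hx' : 0 < ‖x‖ := norm_pos_iff.2 hx
      have hm := isMinOn_iff.1 hmin (‖x‖⁻¹ • x) (by simp [norm_smul, hx'.ne'])
      simp only [map_smul, inner_smul_left, inner_smul_right, conj_trivial] at hm
      calc inner ℝ (T z) z * ‖x‖ ^ 2 ≤ (‖x‖⁻¹ * (‖x‖⁻¹ * inner ℝ (T x) x)) * ‖x‖ ^ 2 := by gcongr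
        _ = _ := by field_simp
  · exact (T.le_opNorm x).trans (by gcongr; linarith)

end BNGD

/-- Convergence of BNGD for small learning rate (general initial values): if `ε_a ∈ (0,1]`,
there is `ε₀ > 0` (depending only on `H`, `u`, `a₀`, `ε_a`) such that whenever
`ε/‖w₀‖² < ε₀` the BNGD iterates converge, the limit being a global minimizer or a
saddle point (`a* = 0`, `w*ᵀg = 0`) of the BN-OLS objective. -/
theorem bngd_convergence_small_stepsize
    {d : ℕ} (hd : 0 < d)
    (H : Matrix (Fin d) (Fin d) ℝ) (hH : H.PosDef)
    (u : Fin d → ℝ) (hu : u ≠ 0)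
    (εa : ℝ) (hεa : 0 < εa) (hεa1 : εa ≤ 1)
    (g : Fin d → ℝ) (hg : g = H.mulVec u)
    (σ : (Fin d → ℝ) → ℝ) (hσ : ∀ v, σ v = Real.sqrt (v ⬝ᵥ H.mulVec v))
    (a₀ : ℝ) :
    ∃ ε₀ > (0 : ℝ), ∀ w₀ : Fin d → ℝ, w₀ ≠ 0 →
      ∀ ε > (0 : ℝ), ε / (w₀ ⬝ᵥ w₀) < ε₀ →
        ∀ (a : ℕ → ℝ) (w : ℕ → Fin d → ℝ),
          a 0 = a₀ → w 0 = w₀ →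
          (∀ k, a (k + 1) = a k + εa * ((w k ⬝ᵥ g) / σ (w k) - a k)) →
          (∀ k, w (k + 1) = w k +
            (ε * (a k / σ (w k))) • (g - ((w k ⬝ᵥ g) / (σ (w k)) ^ 2) • H.mulVec (w k))) →
          ∃ (astar : ℝ) (wstar : Fin d → ℝ),
            Tendsto a atTop (nhds astar) ∧ Tendsto w atTop (nhds wstar) ∧
            ((∃ c : ℝ, c ≠ 0 ∧ wstar = c • u ∧ astar = (wstar ⬝ᵥ g) / σ wstar) ∨
              (astar = 0 ∧ wstar ⬝ᵥ g = 0)) := by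
  subst hg
  set T := toEuclideanCLM (n := Fin d) (𝕜 := ℝ) H with hT
  obtain ⟨l, L, hE⟩ := BNGD.exists_elliptic hH hd
  set A := max |a₀| (BNGD.energyNorm T (WithLp.toLp 2 u)) with hA
  obtain ⟨δ, hδ, hsmall⟩ := hE.exists_smallStep (WithLp.toLp 2 u)
    (A := A) (le_max_of_le_left (abs_nonneg _))
  have hinner : ∀ x y : Fin d → ℝ, inner ℝ (WithLp.toLp 2 x) (WithLp.toLp 2 y) = x ⬝ᵥ y :=
    fun x y => by rw [EuclideanSpace.inner_toLp_toLp, star_trivial, dotProduct_comm]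
  have hTv : ∀ x : Fin d → ℝ, T (WithLp.toLp 2 x) = WithLp.toLp 2 (H *ᵥ x) :=
    fun x => toEuclideanCLM_toLp H x
  have hσT : ∀ x : Fin d → ℝ, BNGD.energyNorm T (WithLp.toLp 2 x) = σ x := fun x => by
    rw [BNGD.energyNorm, hTv, hinner, hσ, dotProduct_comm]
  have hquot : ∀ x : Fin d → ℝ, BNGD.quotient T (WithLp.toLp 2 u) (WithLp.toLp 2 x)
      = (x ⬝ᵥ H *ᵥ u) / σ x := fun x => by
    rw [BNGD.quotient, hTv, hinner, hσT]
  refine ⟨δ, hδ, fun w₀ hw₀ ε hε hεδ a w ha0 hw0 ha hw => ?_⟩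
  have hnorm : ‖WithLp.toLp 2 w₀‖ ^ 2 = w₀ ⬝ᵥ w₀ := by
    rw [← real_inner_self_eq_norm_sq, hinner]
  have hw₀' : 0 < ‖WithLp.toLp 2 w₀‖ := by simpa using hw₀
  have hrun : BNGD.Run T (WithLp.toLp 2 u) l L A εa ε a (fun k => WithLp.toLp 2 (w k)) := by
    refine ⟨hE, hεa, hεa1, hε, by simpa [hw0] using hw₀, by rw [ha0]; exact le_max_left _ _,
      le_max_right _ _, ?_, fun k => by rw [ha, hquot], fun k => ?_⟩
    · simp only [hw0]
      refine hsmall _ _ hε (by positivity) ?_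
      rwa [hnorm]
    · rw [hw, BNGD.stepW, BNGD.direction, hTv, hTv, hinner, hσT]
      rfl
  obtain ⟨s, x, hs, hx, hlim⟩ := hrun.converges
  refine ⟨s, x.ofLp, hs, ((PiLp.continuous_ofLp 2 _).tendsto x).comp hx, ?_⟩
  rcases hlim with ⟨c, hc, rfl, rfl⟩ | ⟨rfl, hxu⟩
  · refine Or.inl ⟨c, hc, rfl, ?_⟩
    exact hquot (c • u)
  · refine Or.inr ⟨rfl, ?_⟩
    rwa [hTv, ← WithLp.toLp_ofLp 2 x, hinner] at hxu
end
end

section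
/- BNGD converges for arbitrary learning rate (main convergence theorem): Let ε_a ∈ (0, 1] and ε > 0 be arbitrary. Then for any initial value (a₀, w₀) with w₀ ≠ 0, the BNGD iterates (a_k, w_k) converge to a limit (a*, w*) with w* ≠ 0, and (a*, w*) is a stationary point of the BN-OLS objective J (the gradient of J vanishes at (a*, w*)). Moreover ‖w_k‖ converges to a finite limit. -/
open Matrix Filter Topology

noncomputable section

section QuadraticForm

variable {n : Type*} [Fintype n]

lemma norm_sq_le_dotProduct_self (x : n → ℝ) : ‖x‖ ^ 2 ≤ x ⬝ᵥ x := by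
  have h : ‖x‖ ≤ Real.sqrt (x ⬝ᵥ x) := by
    refine (pi_norm_le_iff_of_nonneg (Real.sqrt_nonneg _)).2 fun i => Real.le_sqrt_of_sq_le ?_
    rw [Real.norm_eq_abs, sq_abs, sq]
    exact Finset.single_le_sum (f := fun j => x j * x j) (fun _ _ => mul_self_nonneg _)
      (Finset.mem_univ i)
  have h0 : 0 ≤ x ⬝ᵥ x := Finset.sum_nonneg fun _ _ => mul_self_nonneg _
  calc ‖x‖ ^ 2 ≤ Real.sqrt (x ⬝ᵥ x) ^ 2 := by gcongr
    _ = x ⬝ᵥ x := Real.sq_sqrt h0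

lemma dotProduct_self_nonneg_real (x : n → ℝ) : 0 ≤ x ⬝ᵥ x :=
  Finset.sum_nonneg fun _ _ => mul_self_nonneg _

lemma dotProduct_self_pos_real {x : n → ℝ} (hx : x ≠ 0) : 0 < x ⬝ᵥ x :=
  lt_of_le_of_ne (dotProduct_self_nonneg_real x) fun h => hx (dotProduct_self_eq_zero.1 h.symm)

lemma sq_dotProduct_le (x y : n → ℝ) : (x ⬝ᵥ y) ^ 2 ≤ (x ⬝ᵥ x) * (y ⬝ᵥ y) := by
  simpa [dotProduct, sq] using Finset.sum_mul_sq_le_sq_mul_sq Finset.univ x y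

variable {H : Matrix n n ℝ}

lemma Matrix.PosDef.quad_pos (hH : H.PosDef) {x : n → ℝ} (hx : x ≠ 0) : 0 < x ⬝ᵥ H *ᵥ x := by
  simpa using hH.dotProduct_mulVec_pos hx

lemma Matrix.PosDef.quad_nonneg (hH : H.PosDef) (x : n → ℝ) : 0 ≤ x ⬝ᵥ H *ᵥ x := by
  simpa using hH.posSemidef.dotProduct_mulVec_nonneg x

lemma Matrix.PosDef.dotProduct_mulVec_symm (hH : H.PosDef) (x y : n → ℝ) :
    x ⬝ᵥ H *ᵥ y = y ⬝ᵥ H *ᵥ x := by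
  have hT : Hᵀ = H := by simpa using hH.isHermitian.eq
  rw [Matrix.dotProduct_mulVec, dotProduct_comm, ← Matrix.mulVec_transpose, hT]

lemma Matrix.PosDef.sq_dotProduct_mulVec_le (hH : H.PosDef) (x y : n → ℝ) :
    (x ⬝ᵥ H *ᵥ y) ^ 2 ≤ (x ⬝ᵥ H *ᵥ x) * (y ⬝ᵥ H *ᵥ y) := by
  by_cases hy : y = 0
  · simp [hy]
  have hQ := hH.quad_pos hy
  have h := hH.quad_nonneg ((y ⬝ᵥ H *ᵥ y) • x - (x ⬝ᵥ H *ᵥ y) • y)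
  simp only [Matrix.mulVec_sub, Matrix.mulVec_smul, sub_dotProduct, dotProduct_sub,
    smul_dotProduct, dotProduct_smul, smul_eq_mul, hH.dotProduct_mulVec_symm y x] at h
  have : 0 ≤ (y ⬝ᵥ H *ᵥ y) * ((x ⬝ᵥ H *ᵥ x) * (y ⬝ᵥ H *ᵥ y) - (x ⬝ᵥ H *ᵥ y) ^ 2) := by
    linarith
  linarith [nonneg_of_mul_nonneg_right this hQ]

lemma Matrix.PosDef.exists_quad_bounds (hH : H.PosDef) :
    ∃ l L : ℝ, 0 < l ∧ 0 < L ∧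
      ∀ x : n → ℝ, l * (x ⬝ᵥ x) ≤ x ⬝ᵥ H *ᵥ x ∧ x ⬝ᵥ H *ᵥ x ≤ L * (x ⬝ᵥ x) := by
  rcases isEmpty_or_nonempty n with hn | ⟨⟨i⟩⟩
  · exact ⟨1, 1, one_pos, one_pos, fun x => by simp [dotProduct]⟩
  classical
  set S : Set (n → ℝ) := {x | x ⬝ᵥ x = 1}
  have hS : IsCompact S := by
    refine Metric.isCompact_of_isClosed_isBounded (isClosed_eq (by fun_prop) (by fun_prop)) ?_
    refine isBounded_iff_forall_norm_le.2 ⟨1, fun x hx => ?_⟩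
    have h1 := norm_sq_le_dotProduct_self x
    rw [show x ⬝ᵥ x = 1 from hx] at h1
    nlinarith [norm_nonneg x]
  have hne : S.Nonempty := ⟨Pi.single i 1, by simp [S]⟩
  have hc : ContinuousOn (fun x : n → ℝ => x ⬝ᵥ H *ᵥ x) S := by fun_prop
  obtain ⟨p, hp, hpmin⟩ := hS.exists_isMinOn hne hc
  obtain ⟨q, hq, hqmax⟩ := hS.exists_isMaxOn hne hc
  have hS0 : ∀ x ∈ S, x ≠ 0 := by
    rintro x hx rfl
    simp [S] at hx
  refine ⟨p ⬝ᵥ H *ᵥ p, q ⬝ᵥ H *ᵥ q, hH.quad_pos (hS0 p hp), hH.quad_pos (hS0 q hq), fun x => ?_⟩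
  by_cases hx : x = 0
  · simp [hx]
  have hN := dotProduct_self_pos_real hx
  have hs := Real.sqrt_pos.2 hN
  have hss := Real.sq_sqrt hN.le
  set s := Real.sqrt (x ⬝ᵥ x)
  have hmem : s⁻¹ • x ∈ S := by
    simp only [S, Set.mem_ofPred_eq, smul_dotProduct, dotProduct_smul, smul_eq_mul, ← hss]
    field_simp
  have hQ : (s⁻¹ • x) ⬝ᵥ H *ᵥ (s⁻¹ • x) = (x ⬝ᵥ H *ᵥ x) / s ^ 2 := by
    simp only [Matrix.mulVec_smul, smul_dotProduct, dotProduct_smul, smul_eq_mul]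
    field_simp
  have h1 : p ⬝ᵥ H *ᵥ p ≤ (s⁻¹ • x) ⬝ᵥ H *ᵥ (s⁻¹ • x) := hpmin hmem
  have h2 : (s⁻¹ • x) ⬝ᵥ H *ᵥ (s⁻¹ • x) ≤ q ⬝ᵥ H *ᵥ q := hqmax hmem
  rw [hQ, hss] at h1 h2
  exact ⟨(le_div_iff₀ hN).1 h1, (div_le_iff₀ hN).1 h2⟩

end QuadraticForm

section Scalar

/-- With a small effective step `1 / σ²`, one step increases `y² - (a - y)²` by at least a multiple
of the increment of `‖w‖²`. -/
lemma lyapunov_step {ε ρ G A Λ : ℝ} (hε : 0 < ε) (hρ : 0 < ρ) (hρ1 : ρ ≤ 1) (hΛ : 0 < Λ) :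
    ∃ κ₀ > 0, ∀ κ a y p q t s D y' a' : ℝ, 0 < κ → κ ≤ κ₀ → 0 ≤ p → q ^ 2 ≤ t → t ≤ Λ * p →
      p ≤ Λ * G ^ 2 → y ^ 2 ≤ G ^ 2 → a ^ 2 ≤ A ^ 2 → s = ε * a * κ → 0 < D →
      D ^ 2 = 1 + 2 * s * q + s ^ 2 * t → y' * D = y + s * (p + y * q) →
      a' = a + ρ * (y - a) →
      ε / 2 * (a ^ 2 * p * κ) ≤ (y' ^ 2 - (a' - y') ^ 2) - (y ^ 2 - (a - y) ^ 2) := by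
  obtain ⟨P, hPd⟩ : ∃ P, P = Λ * G ^ 2 := ⟨_, rfl⟩
  have hP : 0 ≤ P := by rw [hPd]; positivity
  obtain ⟨C₁, hC₁d⟩ : ∃ c, c = ε ^ 2 * A ^ 2 * (Λ * P) := ⟨_, rfl⟩
  obtain ⟨C₂, hC₂d⟩ : ∃ c, c = 4 * ε ^ 2 * P / ρ + P * ε ^ 2 := ⟨_, rfl⟩
  obtain ⟨C₃, hC₃d⟩ : ∃ c, c = 66 * P * ε ^ 2 / ρ := ⟨_, rfl⟩
  have hC₁ : 0 ≤ C₁ := by rw [hC₁d]; positivity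
  have hC₂ : 0 ≤ C₂ := by rw [hC₂d]; positivity
  have hC₃ : 0 ≤ C₃ := by rw [hC₃d]; positivity
  refine ⟨min 1 (min (1 / (64 * (C₁ + 1))) (min (ε / (2 * (C₂ + 1))) (ε / (4 * (C₃ + 1))))),
    by positivity, ?_⟩
  intro κ a y p q t s D y' a' hκ hκ₀ hp hqt htp hpP hy ha hs hD hD2 hy' ha'
  simp only [le_min_iff] at hκ₀
  obtain ⟨k1, k2, k3, k4⟩ := hκ₀
  rw [le_div_iff₀ (by positivity)] at k2 k3 k4
  have c1 : C₁ * κ ≤ 1 / 64 := by linarith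
  have c2 : C₂ * κ ≤ ε / 2 := by linarith
  have c3 : C₃ * κ ≤ ε / 4 := by linarith
  have ht : 0 ≤ t := (sq_nonneg q).trans hqt
  obtain ⟨b, hb⟩ : ∃ b, b = a ^ 2 * p * κ := ⟨_, rfl⟩
  rw [← hb]
  have hb0 : 0 ≤ b := by rw [hb]; positivity
  have hsp : s ^ 2 * p = ε ^ 2 * κ * b := by rw [hs, hb]; ring
  have hst : s ^ 2 * t ≤ Λ * (ε ^ 2 * κ * b) := by
    calc s ^ 2 * t ≤ s ^ 2 * (Λ * p) := by gcongr
      _ = Λ * (s ^ 2 * p) := by ring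
      _ = _ := by rw [hsp]
  have hst' : s ^ 2 * t ≤ 1 / 64 := by
    have e1 : s ^ 2 * t ≤ C₁ * κ ^ 2 := by
      calc s ^ 2 * t = ε ^ 2 * a ^ 2 * κ ^ 2 * t := by rw [hs]; ring
        _ ≤ ε ^ 2 * A ^ 2 * κ ^ 2 * (Λ * P) := by
          gcongr; exact htp.trans (by rw [hPd]; gcongr)
        _ = C₁ * κ ^ 2 := by rw [hC₁d]; ring
    have e2 : C₁ * κ ^ 2 ≤ C₁ * κ := by
      rw [sq, ← mul_assoc]; exact mul_le_of_le_one_right (by positivity) k1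
    linarith
  have hst0 : 0 ≤ s ^ 2 * t := by positivity
  have hsq2 : (s * q) ^ 2 ≤ s ^ 2 * t := by rw [mul_pow]; gcongr
  have hsq : |s * q| ≤ 1 / 8 := abs_le_of_sq_le_sq (by linarith) (by norm_num)
  obtain ⟨hsq_l, hsq_u⟩ := abs_le.1 hsq
  have hDl : 1 / 2 ≤ D ^ 2 := by rw [hD2]; linarith
  have hDu : D ^ 2 ≤ 2 := by rw [hD2]; linarith
  obtain ⟨δ, hδ⟩ : ∃ δ, δ = a - y := ⟨_, rfl⟩
  rw [← hδ]
  have hcross : 2 * ε * (δ * a * p * κ) ≤ ρ / 4 * δ ^ 2 + 4 * ε ^ 2 * P / ρ * κ * b := by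
    have e1 : 2 * ε * (δ * a * p * κ) ≤ ρ / 4 * δ ^ 2 + 4 / ρ * (ε * a * p * κ) ^ 2 := by
      have e2 : ρ / 4 * δ ^ 2 + 4 / ρ * (ε * a * p * κ) ^ 2 - 2 * ε * (δ * a * p * κ)
        = (ρ * δ - 4 * (ε * a * p * κ)) ^ 2 / (4 * ρ) := by field_simp; ring
      have e3 : 0 ≤ (ρ * δ - 4 * (ε * a * p * κ)) ^ 2 / (4 * ρ) := by positivity
      linarith
    have e4 : 4 / ρ * (ε * a * p * κ) ^ 2 = 4 * ε ^ 2 * p / ρ * κ * b := by rw [hb]; ring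
    have e5 : 4 * ε ^ 2 * p / ρ * κ * b ≤ 4 * ε ^ 2 * P / ρ * κ * b := by
      rw [hPd]; gcongr
    linarith
  have hyst : y ^ 2 * (s ^ 2 * t) ≤ P * ε ^ 2 * κ * b := by
    calc y ^ 2 * (s ^ 2 * t) ≤ G ^ 2 * (Λ * (ε ^ 2 * κ * b)) := by gcongr
      _ = P * ε ^ 2 * κ * b := by rw [hPd]; ring
  have hgain : (y' ^ 2 - y ^ 2) * D ^ 2 =
      2 * y * s * p + s ^ 2 * (p + y * q) ^ 2 - y ^ 2 * (s ^ 2 * t) := by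
    have : (y' ^ 2 - y ^ 2) * D ^ 2 = (y' * D) ^ 2 - y ^ 2 * D ^ 2 := by ring
    rw [this, hy', hD2]; ring
  have hysp : 2 * y * s * p = 2 * ε * b - 2 * ε * (δ * a * p * κ) := by
    rw [hs, hb, hδ]; ring
  have hgain' : 3 / 2 * ε * b - ρ / 4 * δ ^ 2 ≤ (y' ^ 2 - y ^ 2) * D ^ 2 := by
    have e1 : C₂ * κ * b ≤ ε / 2 * b := by
      gcongr
    have e2 : C₂ * κ * b = 4 * ε ^ 2 * P / ρ * κ * b + P * ε ^ 2 * κ * b := by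
      rw [hC₂d]; ring
    have e3 : 0 ≤ s ^ 2 * (p + y * q) ^ 2 := by positivity
    rw [hgain, hysp]; linarith
  have hgain'' : 3 / 4 * ε * b - ρ / 2 * δ ^ 2 ≤ y' ^ 2 - y ^ 2 := by
    have e1 : 0 ≤ ε * b := by positivity
    have e2 : 0 ≤ ρ * δ ^ 2 := by positivity
    by_contra! hlt
    have e3 : (y' ^ 2 - y ^ 2) * D ^ 2 < (3 / 4 * ε * b - ρ / 2 * δ ^ 2) * D ^ 2 := by gcongr
    have e4 : ε * b * D ^ 2 ≤ ε * b * 2 := by gcongr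
    have e5 : ρ * δ ^ 2 * (1 / 2) ≤ ρ * δ ^ 2 * D ^ 2 := by gcongr
    linarith
  have hdiff : (y' - y) ^ 2 ≤ 66 * P * ε ^ 2 * κ * b := by
    have e0 : (1 - D) ^ 2 ≤ 9 * (s ^ 2 * t) := by
      have e1 : (1 - D) ^ 2 ≤ (1 - D ^ 2) ^ 2 := by
        have : (1 - D ^ 2) ^ 2 = (1 - D) ^ 2 * (1 + D) ^ 2 := by ring
        rw [this]; exact le_mul_of_one_le_right (sq_nonneg _) (one_le_pow₀ (by linarith))
      have e2 : (1 - D ^ 2) ^ 2 ≤ 2 * (4 * (s * q) ^ 2 + (s ^ 2 * t) ^ 2) := by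
        have : 2 * (4 * (s * q) ^ 2 + (s ^ 2 * t) ^ 2) - (1 - D ^ 2) ^ 2
            = (2 * (s * q) - s ^ 2 * t) ^ 2 := by rw [hD2]; ring
        linarith [sq_nonneg (2 * (s * q) - s ^ 2 * t)]
      have e3 : (s ^ 2 * t) ^ 2 ≤ (s ^ 2 * t) * (1 / 64) := by rw [sq]; gcongr
      linarith
    have e1 : ((y' - y) * D) ^ 2 ≤ 3 * ((s * p) ^ 2 + (y * (1 - D)) ^ 2 + (y * (s * q)) ^ 2) := by
      have : (y' - y) * D = s * p + y * (1 - D) + y * (s * q) := by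
        rw [sub_mul, hy']; ring
      rw [this]
      linarith [sq_nonneg (s * p - y * (1 - D)), sq_nonneg (s * p - y * (s * q)),
        sq_nonneg (y * (1 - D) - y * (s * q))]
    have e2 : (s * p) ^ 2 ≤ P * ε ^ 2 * κ * b := by
      have : (s * p) ^ 2 = (ε ^ 2 * κ * b) * p := by rw [← hsp]; ring
      rw [this]
      calc (ε ^ 2 * κ * b) * p ≤ (ε ^ 2 * κ * b) * P := by rw [hPd]; gcongr
        _ = _ := by ring
    have e3 : (y * (1 - D)) ^ 2 ≤ 9 * (P * ε ^ 2 * κ * b) := by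
      calc (y * (1 - D)) ^ 2 = y ^ 2 * (1 - D) ^ 2 := by ring
        _ ≤ y ^ 2 * (9 * (s ^ 2 * t)) := by gcongr
        _ = 9 * (y ^ 2 * (s ^ 2 * t)) := by ring
        _ ≤ _ := by gcongr
    have e4 : (y * (s * q)) ^ 2 ≤ P * ε ^ 2 * κ * b := by
      rw [mul_pow]; exact (mul_le_mul_of_nonneg_left hsq2 (sq_nonneg y)).trans hyst
    have e5 : ((y' - y) * D) ^ 2 ≤ 33 * (P * ε ^ 2 * κ * b) := by linarith
    rw [mul_pow] at e5
    have e6 : (y' - y) ^ 2 * (1 / 2) ≤ (y' - y) ^ 2 * D ^ 2 := by gcongr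
    linarith
  have hδ' : (a' - y') ^ 2 ≤ (1 - ρ) * δ ^ 2 + (y' - y) ^ 2 / ρ := by
    have e1 : (1 - ρ) * δ ^ 2 + (y' - y) ^ 2 / ρ - (a' - y') ^ 2
        = (1 - ρ) * (ρ * δ + (y' - y)) ^ 2 / ρ := by
      rw [ha', hδ]; field_simp; ring
    have e2 : 0 ≤ (1 - ρ) * (ρ * δ + (y' - y)) ^ 2 / ρ := by
      have : 0 ≤ 1 - ρ := by linarith
      positivity
    linarith
  have hlast : (y' - y) ^ 2 / ρ ≤ ε / 4 * b := by
    calc (y' - y) ^ 2 / ρ ≤ 66 * P * ε ^ 2 * κ * b / ρ := by gcongr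
      _ = (C₃ * κ) * b := by rw [hC₃d]; ring
      _ ≤ ε / 4 * b := by gcongr
  have : 0 ≤ ρ * δ ^ 2 := by positivity
  linarith

end Scalar

section Sequences

lemma tendsto_zero_of_sq_le {f g : ℕ → ℝ} (h : ∀ᶠ k in atTop, f k ^ 2 ≤ g k)
    (hg : Tendsto g atTop (𝓝 0)) : Tendsto f atTop (𝓝 0) := by
  have hs : Tendsto (fun k => Real.sqrt (g k)) atTop (𝓝 0) := by
    simpa using hg.sqrt
  exact squeeze_zero_norm' (h.mono fun _ hk => Real.abs_le_sqrt hk) hs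

lemma tendsto_zero_of_contraction {c : ℝ} (hc0 : 0 ≤ c) (hc1 : c < 1) {x e : ℕ → ℝ}
    (hx : ∀ k, x (k + 1) = c * x k + e k) (he : Tendsto e atTop (𝓝 0)) :
    Tendsto x atTop (𝓝 0) := by
  rw [Metric.tendsto_atTop] at he ⊢
  intro η hη
  obtain ⟨K, hK⟩ := he ((1 - c) * (η / 2)) (by nlinarith)
  have hb : ∀ n, |x (K + n)| ≤ η / 2 + c ^ n * |x K| := by
    intro n
    induction n with
    | zero => simp; positivity
    | succ n ih =>
      have h1 := hK (K + n) (by omega)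
      rw [Real.dist_eq, sub_zero] at h1
      calc |x (K + (n + 1))| = |c * x (K + n) + e (K + n)| := by rw [← hx]; rfl
        _ ≤ c * |x (K + n)| + |e (K + n)| := by
          refine (abs_add_le _ _).trans_eq ?_
          rw [abs_mul, abs_of_nonneg hc0]
        _ ≤ c * (η / 2 + c ^ n * |x K|) + (1 - c) * (η / 2) := by gcongr
        _ = η / 2 + c ^ (n + 1) * |x K| := by ring
  have hp : Tendsto (fun n => c ^ n * |x K|) atTop (𝓝 0) := by
    simpa using (tendsto_pow_atTop_nhds_zero_of_lt_one hc0 hc1).mul_const |x K|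
  obtain ⟨M, hM⟩ := (hp.eventually (gt_mem_nhds (half_pos hη))).exists_forall_of_atTop
  refine ⟨K + M, fun n hn => ?_⟩
  obtain ⟨m, rfl⟩ := Nat.exists_eq_add_of_le (show K ≤ n by omega)
  rw [Real.dist_eq, sub_zero]
  linarith [hb m, hM m (by omega)]

lemma eventually_or_eventually_not_of_step {P : ℕ → Prop} (h : ∀ᶠ k in atTop, P k ↔ P (k + 1)) :
    (∀ᶠ k in atTop, P k) ∨ ∀ᶠ k in atTop, ¬ P k := by
  obtain ⟨K, hK⟩ := h.exists_forall_of_atTop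
  have key : ∀ k ≥ K, (P k ↔ P K) := by
    intro k hk
    induction k, hk using Nat.le_induction with
    | base => rfl
    | succ k hk ih => rw [← hK k hk, ih]
  by_cases hP : P K
  · exact .inl (eventually_atTop.2 ⟨K, fun k hk => (key k hk).2 hP⟩)
  · exact .inr (eventually_atTop.2 ⟨K, fun k hk => mt (key k hk).1 hP⟩)

/-- A slowly varying sequence along which `y² (G² - y²) → 0` settles at a root. -/
lemma tendsto_of_slow_of_tendsto_zero {G : ℝ} (hG : 0 < G) {y : ℕ → ℝ}
    (hslow : Tendsto (fun k => y (k + 1) - y k) atTop (𝓝 0))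
    (hy : Tendsto (fun k => y k ^ 2 * (G ^ 2 - y k ^ 2)) atTop (𝓝 0)) :
    Tendsto y atTop (𝓝 0) ∨ Tendsto y atTop (𝓝 G) ∨ Tendsto y atTop (𝓝 (-G)) := by
  have h1 : ∀ᶠ k in atTop, |y (k + 1) - y k| < G / 4 := by
    have h : |(0 : ℝ)| < G / 4 := by rw [abs_zero]; positivity
    exact hslow.abs.eventually (gt_mem_nhds h)
  have h2 : ∀ᶠ k in atTop, y k ^ 2 * (G ^ 2 - y k ^ 2) < G ^ 4 / 16 :=
    hy.eventually (gt_mem_nhds (by positivity))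
  have gap : ∀ x : ℝ, x ^ 2 * (G ^ 2 - x ^ 2) < G ^ 4 / 16 → |x| < G / 2 ∨ 3 * G / 4 < |x| := by
    intro x hx
    by_contra! h
    have e1 : (G / 2) ^ 2 ≤ x ^ 2 := by
      rw [← sq_abs x]; exact pow_le_pow_left₀ (by positivity) h.1 2
    have e2 : x ^ 2 ≤ (3 * G / 4) ^ 2 := by
      rw [← sq_abs x]; exact pow_le_pow_left₀ (abs_nonneg x) h.2 2
    have e3 : (G / 2) ^ 2 * (G ^ 2 - (3 * G / 4) ^ 2) ≤ x ^ 2 * (G ^ 2 - x ^ 2) := by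
      gcongr
      nlinarith
    nlinarith [pow_pos hG 4]
  have hright : (∀ᶠ k in atTop, G / 2 < y k) ∨ ∀ᶠ k in atTop, ¬ G / 2 < y k := by
    refine eventually_or_eventually_not_of_step ?_
    filter_upwards [h1, h2, (tendsto_add_atTop_nat 1).eventually h2] with k a1 a2 a3
    have b2 := gap _ a2
    have b3 := gap _ a3
    simp only [abs_lt, lt_abs] at a1 b2 b3
    constructor <;> intro h <;> rcases b2 with b2 | b2 | b2 <;> rcases b3 with b3 | b3 | b3 <;>
      linarith
  have hleft : (∀ᶠ k in atTop, y k < -(G / 2)) ∨ ∀ᶠ k in atTop, ¬ y k < -(G / 2) := by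
    refine eventually_or_eventually_not_of_step ?_
    filter_upwards [h1, h2, (tendsto_add_atTop_nat 1).eventually h2] with k a1 a2 a3
    have b2 := gap _ a2
    have b3 := gap _ a3
    simp only [abs_lt, lt_abs] at a1 b2 b3
    constructor <;> intro h <;> rcases b2 with b2 | b2 | b2 <;> rcases b3 with b3 | b3 | b3 <;>
      linarith
  have outer : ∀ x : ℝ, G / 2 < x →
      (x - G) ^ 2 ≤ (8 / G ^ 3) ^ 2 * (x ^ 2 * (G ^ 2 - x ^ 2)) ^ 2 := by
    intro x hx
    have e1 : G ^ 3 / 8 ≤ x ^ 2 * (G + x) := by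
      calc G ^ 3 / 8 ≤ (G / 2) ^ 2 * (G + G / 2) := by nlinarith [pow_pos hG 3]
        _ ≤ x ^ 2 * (G + x) := by gcongr
    have e2 : 1 ≤ 8 / G ^ 3 * (x ^ 2 * (G + x)) := by
      rw [div_mul_eq_mul_div, le_div_iff₀ (by positivity)]; linarith
    calc (x - G) ^ 2 ≤ (x - G) ^ 2 * (8 / G ^ 3 * (x ^ 2 * (G + x))) ^ 2 :=
          le_mul_of_one_le_right (sq_nonneg _) (one_le_pow₀ e2)
      _ = _ := by ring
  have hlim : Tendsto (fun k => (8 / G ^ 3) ^ 2 * (y k ^ 2 * (G ^ 2 - y k ^ 2)) ^ 2) atTop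
      (𝓝 0) := by
    simpa using (hy.pow 2).const_mul ((8 / G ^ 3) ^ 2)
  rcases hright with hr | hr
  · refine .inr (.inl (tendsto_sub_nhds_zero_iff.1 (tendsto_zero_of_sq_le ?_ hlim)))
    exact hr.mono fun k hk => outer _ hk
  rcases hleft with hl | hl
  · refine .inr (.inr (tendsto_sub_nhds_zero_iff.1 (tendsto_zero_of_sq_le ?_ hlim)))
    filter_upwards [hl] with k hk
    have := outer (-y k) (by linarith)
    rw [neg_sq] at this
    refine le_trans (le_of_eq ?_) this
    ring
  · refine .inl (tendsto_zero_of_sq_le ?_ (by simpa using hy.const_mul (4 / (3 * G ^ 2))))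
    filter_upwards [hr, hl] with k hk1 hk2
    have e1 : y k ^ 2 ≤ (G / 2) ^ 2 := by
      rw [sq_le_sq, abs_of_pos (half_pos hG), abs_le]
      constructor <;> linarith
    have e2 : 1 ≤ 4 / (3 * G ^ 2) * (G ^ 2 - y k ^ 2) := by
      rw [div_mul_eq_mul_div, le_div_iff₀ (by positivity)]; linarith
    calc y k ^ 2 ≤ y k ^ 2 * (4 / (3 * G ^ 2) * (G ^ 2 - y k ^ 2)) :=
          le_mul_of_one_le_right (sq_nonneg _) e2
      _ = _ := by ring

lemma not_tendsto_atTop_of_lyapunov {ε ρ G A Λ l : ℝ} (hε : 0 < ε) (hρ : 0 < ρ) (hρ1 : ρ ≤ 1)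
    (hΛ : 0 < Λ) (hl : 0 < l) {N κ a y p q t s D : ℕ → ℝ} (hκ : ∀ k, 0 < κ k)
    (hκN : ∀ k, κ k * (l * N k) ≤ 1) (hp : ∀ k, 0 ≤ p k) (hqt : ∀ k, q k ^ 2 ≤ t k)
    (htp : ∀ k, t k ≤ Λ * p k) (hpG : ∀ k, p k ≤ Λ * G ^ 2) (hy : ∀ k, y k ^ 2 ≤ G ^ 2)
    (ha : ∀ k, a k ^ 2 ≤ A ^ 2) (hs : ∀ k, s k = ε * a k * κ k) (hD : ∀ k, 0 < D k)
    (hD2 : ∀ k, D k ^ 2 = 1 + 2 * s k * q k + s k ^ 2 * t k)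
    (hyD : ∀ k, y (k + 1) * D k = y k + s k * (p k + y k * q k))
    (haρ : ∀ k, a (k + 1) = a k + ρ * (y k - a k))
    (hN : ∀ k, N (k + 1) = N k + ε ^ 2 * (a k ^ 2 * p k * κ k)) :
    ¬ Tendsto N atTop atTop := by
  intro hlim
  obtain ⟨κ₀, hκ₀, hstep⟩ := lyapunov_step (G := G) (A := A) hε hρ hρ1 hΛ
  obtain ⟨K, hK⟩ := (hlim.eventually_ge_atTop (1 / (l * κ₀))).exists_forall_of_atTop
  have hκK : ∀ k ≥ K, κ k ≤ κ₀ := by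
    intro k hk
    have h1 := hK k hk
    rw [div_le_iff₀ (by positivity)] at h1
    have h2 : κ k * (l * N k) ≤ κ₀ * (l * N k) := by linarith [hκN k]
    refine le_of_mul_le_mul_right h2 (mul_pos hl ?_)
    exact lt_of_lt_of_le (by positivity) (hK k hk)
  have hmono : ∀ k ≥ K, N k - 2 * ε * (y k ^ 2 - (a k - y k) ^ 2)
      ≤ N K - 2 * ε * (y K ^ 2 - (a K - y K) ^ 2) := by
    intro k hk
    induction k, hk using Nat.le_induction with
    | base => rfl
    | succ k hk ih =>
      have h1 := hstep (κ k) (a k) (y k) (p k) (q k) (t k) (s k) (D k) (y (k + 1)) (a (k + 1))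
        (hκ k) (hκK k hk) (hp k) (hqt k) (htp k) (hpG k) (hy k) (ha k) (hs k) (hD k) (hD2 k)
        (hyD k) (haρ k)
      have h2 := mul_le_mul_of_nonneg_left h1 (show 0 ≤ 2 * ε by positivity)
      rw [hN k]
      linarith
  obtain ⟨n, hnK, hn⟩ := ((eventually_ge_atTop K).and (hlim.eventually_gt_atTop
    (N K - 2 * ε * (y K ^ 2 - (a K - y K) ^ 2) + 2 * ε * G ^ 2))).exists
  have h1 := hmono n hnK
  have h2 : 2 * ε * (y n ^ 2 - (a n - y n) ^ 2) ≤ 2 * ε * G ^ 2 := by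
    gcongr
    linarith [hy n, sq_nonneg (a n - y n)]
  linarith

lemma tendsto_sub_zero_of_normalized_step {Λ G : ℝ} {y p q t s D : ℕ → ℝ}
    (hp : ∀ k, 0 ≤ p k) (hqt : ∀ k, q k ^ 2 ≤ t k)
    (htp : ∀ k, t k ≤ Λ * p k) (hpG : ∀ k, p k ≤ Λ * G ^ 2) (hy : ∀ k, y k ^ 2 ≤ G ^ 2)
    (hD : ∀ k, 0 < D k) (hD2 : ∀ k, D k ^ 2 = 1 + 2 * s k * q k + s k ^ 2 * t k)
    (hyD : ∀ k, y (k + 1) * D k = y k + s k * (p k + y k * q k))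
    (hsp : Tendsto (fun k => s k ^ 2 * p k) atTop (𝓝 0)) :
    Tendsto (fun k => y (k + 1) - y k) atTop (𝓝 0) := by
  have hst : Tendsto (fun k => s k ^ 2 * t k) atTop (𝓝 0) := by
    refine squeeze_zero (fun k => mul_nonneg (sq_nonneg _) ((sq_nonneg _).trans (hqt k)))
      (fun k => ?_) (by simpa using hsp.const_mul Λ)
    nlinarith [mul_le_mul_of_nonneg_left (htp k) (sq_nonneg (s k))]
  have h1 : Tendsto (fun k => s k * p k) atTop (𝓝 0) := by
    refine tendsto_zero_of_sq_le (.of_forall fun k => ?_) (by simpa using hsp.mul_const (Λ * G ^ 2))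
    have := hp k
    calc (s k * p k) ^ 2 = s k ^ 2 * p k * p k := by ring
      _ ≤ s k ^ 2 * p k * (Λ * G ^ 2) := by gcongr; exact hpG k
  have h2 : Tendsto (fun k => s k * q k) atTop (𝓝 0) := by
    refine tendsto_zero_of_sq_le (.of_forall fun k => ?_) hst
    rw [mul_pow]; gcongr; exact hqt k
  have h3 : Tendsto (fun k => y k * (s k * q k)) atTop (𝓝 0) := by
    refine tendsto_zero_of_sq_le (.of_forall fun k => ?_)
      (by simpa using (h2.pow 2).const_mul (G ^ 2))
    rw [mul_pow]; exact mul_le_mul_of_nonneg_right (hy k) (sq_nonneg _)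
  have h4 : Tendsto (fun k => D k - 1) atTop (𝓝 0) := by
    have h5 : Tendsto (fun k => 2 * (s k * q k) + s k ^ 2 * t k) atTop (𝓝 0) := by
      simpa using (h2.const_mul 2).add hst
    refine tendsto_zero_of_sq_le (g := fun k => (2 * (s k * q k) + s k ^ 2 * t k) ^ 2)
      (.of_forall fun k => ?_) (by simpa using h5.pow 2)
    have e : 2 * (s k * q k) + s k ^ 2 * t k = (D k - 1) * (D k + 1) := by
      linear_combination -(hD2 k)
    rw [e, mul_pow]
    exact le_mul_of_one_le_right (sq_nonneg _) (one_le_pow₀ (by linarith [hD k]))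
  have h6 : Tendsto (fun k => y (k + 1) * (D k - 1)) atTop (𝓝 0) := by
    refine tendsto_zero_of_sq_le (.of_forall fun k => ?_)
      (by simpa using (h4.pow 2).const_mul (G ^ 2))
    rw [mul_pow]; exact mul_le_mul_of_nonneg_right (hy _) (sq_nonneg _)
  have h7 := (h1.add h3).sub h6
  simp only [add_zero, sub_zero] at h7
  refine h7.congr fun k => ?_
  linear_combination -(hyD k)

variable {n : Type*} [Fintype n]

lemma exists_tendsto_of_summable_drift {w e : ℕ → n → ℝ} {g : n → ℝ} (hg : g ≠ 0) {α : ℕ → ℝ}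
    (hw : ∀ k, w (k + 1) = w k + (α k • g - e k)) (he : Summable e)
    (hwg : Tendsto (fun k => w k ⬝ᵥ g) atTop (𝓝 0)) : ∃ x, Tendsto w atTop (𝓝 x) := by
  have hgg : g ⬝ᵥ g ≠ 0 := (dotProduct_self_pos_real hg).ne'
  set E : ℕ → n → ℝ := fun k => ∑ j ∈ Finset.range k, e j
  have hE : Tendsto E atTop (𝓝 (∑' j, e j)) := he.hasSum.tendsto_sum_nat
  have key : ∀ k, w k = w 0 - E k + ((w k ⬝ᵥ g + E k ⬝ᵥ g - w 0 ⬝ᵥ g) / (g ⬝ᵥ g)) • g := by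
    have h1 : ∀ k, w k = w 0 - E k + (∑ j ∈ Finset.range k, α j) • g := by
      intro k
      induction k with
      | zero => simp [E]
      | succ k ih =>
        rw [hw, ih]
        simp only [E, Finset.sum_range_succ, add_smul]
        abel
    intro k
    have h2 : (w k ⬝ᵥ g + E k ⬝ᵥ g - w 0 ⬝ᵥ g) / (g ⬝ᵥ g) = ∑ j ∈ Finset.range k, α j := by
      rw [div_eq_iff hgg]
      conv_lhs => rw [h1 k]
      simp only [add_dotProduct, sub_dotProduct, smul_dotProduct, smul_eq_mul]
      ring
    rw [h2]
    exact h1 k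
  have hEg : Tendsto (fun k => E k ⬝ᵥ g) atTop (𝓝 ((∑' j, e j) ⬝ᵥ g)) :=
    ((by fun_prop : Continuous fun x : n → ℝ => x ⬝ᵥ g).tendsto _).comp hE
  exact ⟨_, ((hE.const_sub (w 0)).add
    ((((hwg.add hEg).sub_const _).div_const _).smul_const g)).congr fun k => (key k).symm⟩

lemma exists_tendsto_of_direction {w : ℕ → n → ℝ} {u : n → ℝ} (hu : u ≠ 0) {y S : ℕ → ℝ}
    {c M : ℝ} (hc : c ≠ 0) (hS : ∀ k, 0 < S k) (hy : Tendsto y atTop (𝓝 c))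
    (hN : Tendsto (fun k => w k ⬝ᵥ w k) atTop (𝓝 M))
    (hr : Tendsto (fun k => u - (y k / S k) • w k) atTop (𝓝 0)) :
    ∃ x, Tendsto w atTop (𝓝 x) := by
  have hv : Tendsto (fun k => (S k)⁻¹ • w k) atTop (𝓝 (c⁻¹ • u)) := by
    have h1 := (hy.inv₀ hc).smul (hr.const_sub u)
    rw [sub_zero] at h1
    refine h1.congr' ?_
    filter_upwards [hy.eventually_ne hc] with k hk
    rw [sub_sub_cancel, smul_smul]
    congr 1
    field_simp
  have hcu : c⁻¹ • u ≠ 0 := smul_ne_zero (inv_ne_zero hc) hu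
  have hvv : Tendsto (fun k => ((S k)⁻¹ • w k) ⬝ᵥ ((S k)⁻¹ • w k)) atTop
      (𝓝 ((c⁻¹ • u) ⬝ᵥ (c⁻¹ • u))) :=
    ((by fun_prop : Continuous fun x : n → ℝ => x ⬝ᵥ x).tendsto _).comp hv
  have hne := (dotProduct_self_pos_real hcu).ne'
  have hS2 : Tendsto S atTop (𝓝 (Real.sqrt (M / ((c⁻¹ • u) ⬝ᵥ (c⁻¹ • u))))) := by
    refine ((Real.continuous_sqrt.tendsto _).comp (hN.div hvv hne)).congr' ?_
    filter_upwards [hvv.eventually_ne hne] with k hk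
    have hSk := hS k
    simp only [smul_dotProduct, dotProduct_smul, smul_eq_mul] at hk
    simp only [Function.comp, Pi.div_apply, smul_dotProduct, dotProduct_smul, smul_eq_mul]
    have : w k ⬝ᵥ w k ≠ 0 := fun h => hk (by simp [h])
    rw [Real.sqrt_eq_iff_mul_self_eq_of_pos hSk]
    field_simp
  refine ⟨_, (hS2.smul hv).congr fun k => ?_⟩
  rw [smul_smul, mul_inv_cancel₀ (hS k).ne', one_smul]

end Sequences

section Step

variable {n : Type*} [Fintype n] {H : Matrix n n ℝ}

lemma Matrix.PosDef.le_mulVec_dotProduct_self (hH : H.PosDef) {l : ℝ} (hl : 0 < l)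
    (h : ∀ x : n → ℝ, l * (x ⬝ᵥ x) ≤ x ⬝ᵥ H *ᵥ x) (x : n → ℝ) :
    l * (x ⬝ᵥ H *ᵥ x) ≤ (H *ᵥ x) ⬝ᵥ (H *ᵥ x) := by
  by_cases hx : x = 0
  · simp [hx]
  have hQ := hH.quad_pos hx
  have h1 := sq_dotProduct_le x (H *ᵥ x)
  refine le_of_mul_le_mul_left ?_ hQ
  calc (x ⬝ᵥ H *ᵥ x) * (l * (x ⬝ᵥ H *ᵥ x)) = l * (x ⬝ᵥ H *ᵥ x) ^ 2 := by ring
    _ ≤ l * ((x ⬝ᵥ x) * ((H *ᵥ x) ⬝ᵥ (H *ᵥ x))) := by gcongr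
    _ = (l * (x ⬝ᵥ x)) * ((H *ᵥ x) ⬝ᵥ (H *ᵥ x)) := by ring
    _ ≤ (x ⬝ᵥ H *ᵥ x) * ((H *ᵥ x) ⬝ᵥ (H *ᵥ x)) :=
      mul_le_mul_of_nonneg_right (h x) (dotProduct_self_nonneg_real _)

lemma Matrix.PosDef.mulVec_dotProduct_self_le (hH : H.PosDef) {L : ℝ}
    (h : ∀ x : n → ℝ, x ⬝ᵥ H *ᵥ x ≤ L * (x ⬝ᵥ x)) (x : n → ℝ) :
    (H *ᵥ x) ⬝ᵥ (H *ᵥ x) ≤ L * (x ⬝ᵥ H *ᵥ x) := by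
  have hQ := hH.quad_nonneg x
  rcases (dotProduct_self_nonneg_real (H *ᵥ x)).eq_or_lt with h0 | hN
  · have h2 : H *ᵥ x = 0 := dotProduct_self_eq_zero.1 h0.symm
    simp [h2]
  have h1 := hH.sq_dotProduct_mulVec_le (H *ᵥ x) x
  refine le_of_mul_le_mul_left ?_ hN
  calc ((H *ᵥ x) ⬝ᵥ (H *ᵥ x)) * ((H *ᵥ x) ⬝ᵥ (H *ᵥ x)) = ((H *ᵥ x) ⬝ᵥ (H *ᵥ x)) ^ 2 := by ring
    _ ≤ _ := h1
    _ ≤ (L * ((H *ᵥ x) ⬝ᵥ (H *ᵥ x))) * (x ⬝ᵥ H *ᵥ x) := by gcongr; exact h _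
    _ = _ := by ring

lemma residual_eq_mulVec (u w : n → ℝ) (c : ℝ) :
    H *ᵥ u - c • H *ᵥ w = H *ᵥ (u - c • w) := by
  rw [Matrix.mulVec_sub, Matrix.mulVec_smul]

lemma dotProduct_residual (u : n → ℝ) {w : n → ℝ} {σ : ℝ} (hσ : 0 < σ)
    (hσw : σ ^ 2 = w ⬝ᵥ H *ᵥ w) :
    w ⬝ᵥ (H *ᵥ u - ((w ⬝ᵥ H *ᵥ u) / σ ^ 2) • H *ᵥ w) = 0 := by
  rw [dotProduct_sub, dotProduct_smul, smul_eq_mul, ← hσw]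
  field_simp
  ring

lemma Matrix.PosDef.quad_residual (hH : H.PosDef) (u : n → ℝ) {w : n → ℝ} {σ : ℝ} (hσ : 0 < σ)
    (hσw : σ ^ 2 = w ⬝ᵥ H *ᵥ w) :
    (u - ((w ⬝ᵥ H *ᵥ u) / σ ^ 2) • w) ⬝ᵥ H *ᵥ (u - ((w ⬝ᵥ H *ᵥ u) / σ ^ 2) • w) =
      u ⬝ᵥ H *ᵥ u - ((w ⬝ᵥ H *ᵥ u) / σ) ^ 2 := by
  simp only [Matrix.mulVec_sub, Matrix.mulVec_smul, sub_dotProduct, dotProduct_sub,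
    smul_dotProduct, dotProduct_smul, smul_eq_mul, hH.dotProduct_mulVec_symm u w, ← hσw]
  field_simp
  ring

lemma dotProduct_self_add_smul {w h : n → ℝ} (hwh : w ⬝ᵥ h = 0) (c : ℝ) :
    (w + c • h) ⬝ᵥ (w + c • h) = w ⬝ᵥ w + c ^ 2 * (h ⬝ᵥ h) := by
  simp only [add_dotProduct, dotProduct_add, smul_dotProduct, dotProduct_smul, smul_eq_mul,
    dotProduct_comm h w, hwh]
  ring

lemma Matrix.PosDef.quad_add_smul (hH : H.PosDef) (w h : n → ℝ) (c : ℝ) :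
    (w + c • h) ⬝ᵥ H *ᵥ (w + c • h) =
      w ⬝ᵥ H *ᵥ w + 2 * c * (h ⬝ᵥ H *ᵥ w) + c ^ 2 * (h ⬝ᵥ H *ᵥ h) := by
  simp only [Matrix.mulVec_add, Matrix.mulVec_smul, add_dotProduct, dotProduct_add,
    smul_dotProduct, dotProduct_smul, smul_eq_mul, hH.dotProduct_mulVec_symm w h]
  ring

end Step

/-- BNGD converges for arbitrary learning rate: for `ε_a ∈ (0,1]` and any `ε > 0`, the
BNGD iterates `(a_k, w_k)` converge to a limit `(a*, w*)` with `w* ≠ 0` which is a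
stationary point of the BN-OLS objective (the gradient equations `a* = w*ᵀg/σ(w*)` and
`a* · (g − (w*ᵀg/σ(w*)²) H w*) = 0` hold); moreover `‖w_k‖` converges to a finite limit. -/
theorem bngd_convergence_arbitrary_stepsize
    {d : ℕ} (hd : 0 < d)
    (H : Matrix (Fin d) (Fin d) ℝ) (hH : H.PosDef)
    (u : Fin d → ℝ) (hu : u ≠ 0)
    (εa ε : ℝ) (hεa : 0 < εa) (hεa1 : εa ≤ 1) (hε : 0 < ε)
    (g : Fin d → ℝ) (hg : g = H.mulVec u)
    (σ : (Fin d → ℝ) → ℝ) (hσ : ∀ v, σ v = Real.sqrt (v ⬝ᵥ H.mulVec v))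
    (a : ℕ → ℝ) (w : ℕ → Fin d → ℝ) (hw0 : w 0 ≠ 0)
    (ha : ∀ k, a (k + 1) = a k + εa * ((w k ⬝ᵥ g) / σ (w k) - a k))
    (hw : ∀ k, w (k + 1) = w k +
      (ε * (a k / σ (w k))) • (g - ((w k ⬝ᵥ g) / (σ (w k)) ^ 2) • H.mulVec (w k))) :
    ∃ (astar : ℝ) (wstar : Fin d → ℝ), wstar ≠ 0 ∧
      Tendsto a atTop (nhds astar) ∧ Tendsto w atTop (nhds wstar) ∧
      astar = (wstar ⬝ᵥ g) / σ wstar ∧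
      astar • (g - ((wstar ⬝ᵥ g) / (σ wstar) ^ 2) • H.mulVec wstar) = 0 ∧
      ∃ L : ℝ, Tendsto (fun k => Real.sqrt (w k ⬝ᵥ w k)) atTop (nhds L) := by
  obtain ⟨l, L, hl, hL, hbd⟩ := hH.exists_quad_bounds
  have hσsq : ∀ v, σ v ^ 2 = v ⬝ᵥ H *ᵥ v := fun v => by
    rw [hσ, Real.sq_sqrt (hH.quad_nonneg v)]
  have hσpos : ∀ v, v ≠ 0 → 0 < σ v := fun v hv => by
    rw [hσ]; exact Real.sqrt_pos.2 (hH.quad_pos hv)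
  set h : (Fin d → ℝ) → Fin d → ℝ := fun v => g - ((v ⬝ᵥ g) / σ v ^ 2) • H *ᵥ v with hh
  have hvh : ∀ v, v ≠ 0 → v ⬝ᵥ h v = 0 := fun v hv => by
    simp only [hh, hg]; exact dotProduct_residual u (hσpos v hv) (hσsq v)
  have hwne : ∀ k, w k ≠ 0 ∧ w k ⬝ᵥ w k ≤ w (k + 1) ⬝ᵥ w (k + 1) := by
    have step : ∀ k, w k ≠ 0 → w k ⬝ᵥ w k ≤ w (k + 1) ⬝ᵥ w (k + 1) := fun k hk => by
      rw [hw k, dotProduct_self_add_smul (hvh _ hk)]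
      have := dotProduct_self_nonneg_real (h (w k))
      linarith [mul_nonneg (sq_nonneg (ε * (a k / σ (w k)))) this]
    intro k
    induction k with
    | zero => exact ⟨hw0, step 0 hw0⟩
    | succ k ih =>
      have hne : w (k + 1) ≠ 0 := fun h0 => by
        have := dotProduct_self_pos_real ih.1
        have h2 := ih.2
        rw [h0, zero_dotProduct] at h2
        linarith
      exact ⟨hne, step _ hne⟩
  have hmono : Monotone fun k => w k ⬝ᵥ w k := monotone_nat_of_le_succ fun k => (hwne k).2
  have hw_ne : ∀ k, w k ≠ 0 := fun k => (hwne k).1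
  set G := Real.sqrt (u ⬝ᵥ H *ᵥ u)
  have hG : 0 < G := Real.sqrt_pos.2 (hH.quad_pos hu)
  have hG2 : G ^ 2 = u ⬝ᵥ H *ᵥ u := Real.sq_sqrt (hH.quad_nonneg u)
  obtain ⟨S, hS⟩ : ∃ S : ℕ → ℝ, ∀ k, S k = σ (w k) := ⟨_, fun _ => rfl⟩
  obtain ⟨y, hy⟩ : ∃ y : ℕ → ℝ, ∀ k, y k = (w k ⬝ᵥ g) / S k := ⟨_, fun _ => rfl⟩
  obtain ⟨p, hp⟩ : ∃ p : ℕ → ℝ, ∀ k, p k = h (w k) ⬝ᵥ h (w k) := ⟨_, fun _ => rfl⟩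
  obtain ⟨q, hq⟩ : ∃ q : ℕ → ℝ, ∀ k, q k = (h (w k) ⬝ᵥ H *ᵥ w k) / S k := ⟨_, fun _ => rfl⟩
  obtain ⟨t, ht⟩ : ∃ t : ℕ → ℝ, ∀ k, t k = h (w k) ⬝ᵥ H *ᵥ h (w k) := ⟨_, fun _ => rfl⟩
  obtain ⟨κ, hκ⟩ : ∃ κ : ℕ → ℝ, ∀ k, κ k = 1 / S k ^ 2 := ⟨_, fun _ => rfl⟩
  obtain ⟨s, hs⟩ : ∃ s : ℕ → ℝ, ∀ k, s k = ε * a k * κ k := ⟨_, fun _ => rfl⟩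
  obtain ⟨D, hD⟩ : ∃ D : ℕ → ℝ, ∀ k, D k = S (k + 1) / S k := ⟨_, fun _ => rfl⟩
  have hSpos : ∀ k, 0 < S k := fun k => by rw [hS]; exact hσpos _ (hw_ne k)
  have hSsq : ∀ k, S k ^ 2 = w k ⬝ᵥ H *ᵥ w k := fun k => by rw [hS, hσsq]
  have hκpos : ∀ k, 0 < κ k := fun k => by
    have := hSpos k
    rw [hκ]; positivity
  have hDpos : ∀ k, 0 < D k := fun k => by rw [hD]; exact div_pos (hSpos _) (hSpos _)
  have hres : ∀ k, h (w k) = H *ᵥ (u - (y k / S k) • w k) := fun k => by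
    rw [hy, div_div, ← sq, ← residual_eq_mulVec, ← hg, hS]
  have hQres : ∀ k, (u - (y k / S k) • w k) ⬝ᵥ H *ᵥ (u - (y k / S k) • w k) = G ^ 2 - y k ^ 2 :=
    fun k => by
      rw [hG2, hy, div_div, ← sq, hg]
      exact hH.quad_residual u (hSpos k) (hSsq k)
  have hyG : ∀ k, y k ^ 2 ≤ G ^ 2 := fun k => by
    have := hQres k ▸ hH.quad_nonneg (u - (y k / S k) • w k)
    linarith
  have hp0 : ∀ k, 0 ≤ p k := fun k => by rw [hp]; exact dotProduct_self_nonneg_real _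
  have hpl : ∀ k, l * (G ^ 2 - y k ^ 2) ≤ p k := fun k => by
    rw [hp, hres, ← hQres]
    exact hH.le_mulVec_dotProduct_self hl (fun x => (hbd x).1) _
  have hpG : ∀ k, p k ≤ L * G ^ 2 := fun k => by
    have h1 : p k ≤ L * (G ^ 2 - y k ^ 2) := by
      rw [hp, hres, ← hQres]
      exact hH.mulVec_dotProduct_self_le (fun x => (hbd x).2) _
    exact h1.trans (by gcongr; linarith [sq_nonneg (y k)])
  have hqt : ∀ k, q k ^ 2 ≤ t k := fun k => by
    have := hSpos k
    rw [hq, ht, div_pow, div_le_iff₀ (by positivity), hSsq]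
    exact hH.sq_dotProduct_mulVec_le _ _
  have htp : ∀ k, t k ≤ L * p k := fun k => by rw [ht, hp]; exact (hbd _).2
  have haρ : ∀ k, a (k + 1) = a k + εa * (y k - a k) := fun k => by rw [ha, hy, hS]
  have hwk : ∀ k, w (k + 1) = w k + (s k * S k) • h (w k) := fun k => by
    have := hSpos k
    rw [hw k, hs, hκ, ← hS]
    congr 2
    · field_simp
    · rw [hS]
  have hN : ∀ k, w (k + 1) ⬝ᵥ w (k + 1) = w k ⬝ᵥ w k + ε ^ 2 * (a k ^ 2 * p k * κ k) := fun k => by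
    have := hSpos k
    rw [hwk k, dotProduct_self_add_smul (hvh _ (hw_ne k)), hp, hs, hκ]
    field_simp
  have hD2 : ∀ k, D k ^ 2 = 1 + 2 * s k * q k + s k ^ 2 * t k := fun k => by
    have := hSpos k
    rw [hD, div_pow, hSsq (k + 1), hwk k, hH.quad_add_smul, ← hSsq, hq, ht]
    field_simp
  have hyD : ∀ k, y (k + 1) * D k = y k + s k * (p k + y k * q k) := fun k => by
    have h1 := hSpos k
    have h2 := hSpos (k + 1)
    have h3 : h (w k) ⬝ᵥ g = p k + y k * q k := by
      have : h (w k) ⬝ᵥ h (w k) =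
          h (w k) ⬝ᵥ g - (w k ⬝ᵥ g) / S k ^ 2 * (h (w k) ⬝ᵥ H *ᵥ w k) := by
        conv_lhs =>
          rw [show h (w k) ⬝ᵥ h (w k) =
            h (w k) ⬝ᵥ (g - ((w k ⬝ᵥ g) / σ (w k) ^ 2) • H *ᵥ w k) from rfl]
        rw [dotProduct_sub, dotProduct_smul, smul_eq_mul, hS]
      rw [hp, this, hy, hq]
      field_simp
      ring
    rw [← h3, hy (k + 1), hD, hwk k, add_dotProduct, smul_dotProduct, smul_eq_mul, hy k]
    field_simp
  obtain ⟨A, hA⟩ : ∃ A, ∀ k, |a k| ≤ A := by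
    refine ⟨max |a 0| G, fun k => ?_⟩
    induction k with
    | zero => exact le_max_left _ _
    | succ k ih =>
      have h1 : |y k| ≤ max |a 0| G := 
        (abs_le_of_sq_le_sq (hyG k) hG.le).trans (le_max_right _ _)
      have h2 : 0 ≤ 1 - εa := by linarith
      calc |a (k + 1)| = |(1 - εa) * a k + εa * y k| := by rw [haρ]; congr 1; ring
        _ ≤ (1 - εa) * |a k| + εa * |y k| := by
          refine (abs_add_le _ _).trans_eq ?_
          rw [abs_mul, abs_mul, abs_of_nonneg h2, abs_of_pos hεa]
        _ ≤ (1 - εa) * max |a 0| G + εa * max |a 0| G := by gcongr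
        _ = max |a 0| G := by ring
  have hA2 : ∀ k, a k ^ 2 ≤ A ^ 2 := fun k => sq_le_sq.2 ((hA k).trans (le_abs_self A))
  have hκN : ∀ k, κ k * (l * (w k ⬝ᵥ w k)) ≤ 1 := fun k => by
    have := hSpos k
    rw [hκ, one_div_mul_eq_div, div_le_one (by positivity), hSsq]
    exact (hbd _).1
  obtain ⟨M, hM⟩ : ∃ M, Tendsto (fun k => w k ⬝ᵥ w k) atTop (𝓝 M) :=
    (tendsto_atTop_of_monotone hmono).resolve_left
      (not_tendsto_atTop_of_lyapunov hε hεa hεa1 hL hl hκpos hκN hp0 hqt htp hpG hyG hA2 hs hDpos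
        hD2 hyD haρ hN)
  have hNM : ∀ k, w k ⬝ᵥ w k ≤ M := fun k => hmono.ge_of_tendsto hM k
  have hM0 : 0 < M := (dotProduct_self_pos_real hw0).trans_le (hNM 0)
  have hS2M : ∀ k, S k ^ 2 ≤ L * M := fun k => by
    rw [hSsq]; exact (hbd _).2.trans (by gcongr; exact hNM k)
  obtain ⟨B, hκu⟩ : ∃ B, ∀ k, κ k ≤ B := by
    refine ⟨1 / (l * (w 0 ⬝ᵥ w 0)), fun k => ?_⟩
    have h0 := dotProduct_self_pos_real hw0
    rw [le_div_iff₀ (by positivity)]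
    refine le_trans ?_ (hκN k)
    have := hκpos k
    gcongr
    exact hmono (Nat.zero_le k)
  have hsum : Summable fun k => a k ^ 2 * p k := by
    have h1 : Summable fun k => ε ^ 2 * (a k ^ 2 * p k * κ k) := by
      refine summable_of_sum_range_le (c := M - w 0 ⬝ᵥ w 0) (fun k => ?_) (fun m => ?_)
      · have := hp0 k
        have := hκpos k
        positivity
      · have : ∀ k, ε ^ 2 * (a k ^ 2 * p k * κ k) = w (k + 1) ⬝ᵥ w (k + 1) - w k ⬝ᵥ w k :=
          fun k => by rw [hN]; ring
        simp only [this]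
        rw [Finset.sum_range_sub (fun k => w k ⬝ᵥ w k)]
        linarith [hNM m]
    refine Summable.of_nonneg_of_le (fun k => mul_nonneg (sq_nonneg _) (hp0 k)) (fun k => ?_)
      (h1.mul_left (L * M / ε ^ 2))
    have h2 := hSpos k
    have h3 := mul_nonneg (sq_nonneg (a k)) (hp0 k)
    calc a k ^ 2 * p k = S k ^ 2 * (a k ^ 2 * p k * κ k) := by rw [hκ]; field_simp
      _ ≤ L * M * (a k ^ 2 * p k * κ k) := by
        gcongr
        · exact mul_nonneg h3 (hκpos k).le
        · exact hS2M k
      _ = _ := by field_simp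
  have hap := hsum.tendsto_atTop_zero
  have hsp : Tendsto (fun k => s k ^ 2 * p k) atTop (𝓝 0) := by
    refine squeeze_zero (fun k => mul_nonneg (sq_nonneg _) (hp0 k)) (fun k => ?_)
      (by simpa using hap.const_mul (ε ^ 2 * B ^ 2))
    have h3 := mul_nonneg (sq_nonneg (a k)) (hp0 k)
    have h4 := (hκpos k).le
    calc s k ^ 2 * p k = ε ^ 2 * κ k ^ 2 * (a k ^ 2 * p k) := by rw [hs]; ring
      _ ≤ _ := by gcongr; exact hκu k
  have hslow := tendsto_sub_zero_of_normalized_step hp0 hqt htp hpG hyG hDpos hD2 hyD hsp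
  have hδ : Tendsto (fun k => a k - y k) atTop (𝓝 0) :=
    tendsto_zero_of_contraction (c := 1 - εa) (e := fun k => -(y (k + 1) - y k))
      (by linarith) (by linarith) (fun k => by rw [haρ]; ring) (by simpa using hslow.neg)
  have hwell : Tendsto (fun k => y k ^ 2 * (G ^ 2 - y k ^ 2)) atTop (𝓝 0) := by
    have h1 : Tendsto (fun k => 2 / l * (a k ^ 2 * p k) + 2 * G ^ 2 * (a k - y k) ^ 2) atTop
        (𝓝 0) := by
      simpa using (hap.const_mul (2 / l)).add ((hδ.pow 2).const_mul (2 * G ^ 2))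
    refine squeeze_zero (fun k => mul_nonneg (sq_nonneg _) (by linarith [hyG k])) (fun k => ?_) h1
    have h2 : 0 ≤ G ^ 2 - y k ^ 2 := by linarith [hyG k]
    have h3 : G ^ 2 - y k ^ 2 ≤ p k / l := by rw [le_div_iff₀ hl]; linarith [hpl k]
    calc y k ^ 2 * (G ^ 2 - y k ^ 2)
        ≤ (2 * a k ^ 2 + 2 * (a k - y k) ^ 2) * (G ^ 2 - y k ^ 2) := by
          gcongr; linarith [sq_nonneg (2 * a k - y k)]
      _ = 2 * a k ^ 2 * (G ^ 2 - y k ^ 2) + 2 * (a k - y k) ^ 2 * (G ^ 2 - y k ^ 2) := by ring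
      _ ≤ 2 * a k ^ 2 * (p k / l) + 2 * (a k - y k) ^ 2 * G ^ 2 := by
          gcongr; linarith [sq_nonneg (y k)]
      _ = _ := by ring
  have hglobal : ∀ c : ℝ, c ^ 2 = G ^ 2 → Tendsto y atTop (𝓝 c) → ∃ x, Tendsto w atTop (𝓝 x) := by
    intro c hc hyc
    have hc0 : c ≠ 0 := by
      rintro rfl
      have := pow_pos hG 2
      norm_num at hc
      linarith
    refine exists_tendsto_of_direction hu hc0 hSpos hyc hM ?_
    have h1 : Tendsto (fun k => 1 / l * (G ^ 2 - y k ^ 2)) atTop (𝓝 0) := by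
      have e : 1 / l * (G ^ 2 - c ^ 2) = 0 := by rw [hc]; ring
      rw [← e]
      exact ((hyc.pow 2).const_sub (G ^ 2)).const_mul (1 / l)
    rw [tendsto_zero_iff_norm_tendsto_zero]
    refine tendsto_zero_of_sq_le (.of_forall fun k => ?_) h1
    refine (norm_sq_le_dotProduct_self _).trans ?_
    rw [one_div_mul_eq_div, le_div_iff₀ hl, ← hQres]
    linarith [(hbd (u - (y k / S k) • w k)).1]
  have hsaddle : Tendsto y atTop (𝓝 0) → ∃ x, Tendsto w atTop (𝓝 x) := by
    intro hy0
    have hg0 : g ≠ 0 := by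
      rintro h0
      have := hH.quad_pos hu
      rw [← hg, h0, dotProduct_zero] at this
      exact lt_irrefl _ this
    have hsa : Summable fun k => a k ^ 2 := by
      refine Summable.of_norm_bounded_eventually_nat (hsum.mul_left (2 / (l * G ^ 2))) ?_
      have h1 : ∀ᶠ k in atTop, y k ^ 2 < G ^ 2 / 2 :=
        (hy0.pow 2).eventually (gt_mem_nhds (by rw [zero_pow two_ne_zero]; positivity))
      filter_upwards [h1] with k hk
      have h2 : l * G ^ 2 / 2 ≤ p k := by nlinarith [hpl k]
      rw [Real.norm_of_nonneg (sq_nonneg _)]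
      calc a k ^ 2 = 2 / (l * G ^ 2) * (a k ^ 2 * (l * G ^ 2 / 2)) := by field_simp
        _ ≤ _ := by gcongr
    have hsy : Summable fun k => y k ^ 2 := by
      have h1 : Summable fun k => a (k + 1) ^ 2 := (summable_nat_add_iff 1).2 hsa
      refine Summable.of_nonneg_of_le (fun k => sq_nonneg _) (fun k => ?_)
        ((h1.add hsa).mul_left (2 / εa ^ 2))
      have h2 : y k = (a (k + 1) - (1 - εa) * a k) / εa := by
        rw [haρ]; field_simp; ring
      have h3 : ((1 - εa) * a k) ^ 2 ≤ a k ^ 2 := by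
        rw [mul_pow]
        exact mul_le_of_le_one_left (sq_nonneg _) (by nlinarith)
      calc y k ^ 2 = (a (k + 1) - (1 - εa) * a k) ^ 2 / εa ^ 2 := by rw [h2, div_pow]
        _ ≤ (2 * (a (k + 1) ^ 2 + a k ^ 2)) / εa ^ 2 := by
          gcongr
          linarith [sq_nonneg (a (k + 1) + (1 - εa) * a k)]
        _ = _ := by ring
    obtain ⟨C, hC⟩ : ∃ C, ∀ k, ‖H *ᵥ w k‖ ≤ C := by
      refine ⟨Real.sqrt (L * (L * M)), fun k => Real.le_sqrt_of_sq_le ?_⟩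
      refine (norm_sq_le_dotProduct_self _).trans
        ((hH.mulVec_dotProduct_self_le (fun x => (hbd x).2) _).trans ?_)
      rw [← hSsq]
      gcongr
      exact hS2M k
    have hse : Summable fun k => (ε * (a k * y k) * κ k) • H *ᵥ w k := by
      refine Summable.of_norm_bounded
        ((hsa.add hsy).mul_left (ε * B * C)) fun k => ?_
      have h1 : |a k * y k| ≤ a k ^ 2 + y k ^ 2 := by
        rw [abs_le]; constructor <;> nlinarith [sq_nonneg (a k + y k), sq_nonneg (a k - y k)]
      rw [norm_smul, Real.norm_eq_abs, abs_mul, abs_mul, abs_of_pos hε, abs_of_pos (hκpos k)]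
      have hκk := (hκpos k).le
      calc ε * |a k * y k| * κ k * ‖H *ᵥ w k‖
          ≤ ε * (a k ^ 2 + y k ^ 2) * B * C := by
            have hB := hκk.trans (hκu k)
            gcongr
            · exact hκu k
            · exact hC k
        _ = _ := by ring
    refine exists_tendsto_of_summable_drift hg0 (α := fun k => ε * (a k / S k)) (fun k => ?_) hse ?_
    · have h1 := hSpos k
      rw [hw k, smul_sub, smul_smul, ← hS]
      congr 3
      rw [hκ, hy]
      field_simp
    · refine tendsto_zero_of_sq_le (.of_forall fun k => ?_)
        (by simpa using (hy0.pow 2).const_mul (L * M))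
      have h1 := hSpos k
      calc (w k ⬝ᵥ g) ^ 2 = S k ^ 2 * y k ^ 2 := by rw [hy]; field_simp
        _ ≤ _ := by gcongr; exact hS2M k
  obtain ⟨x, hx⟩ : ∃ x, Tendsto w atTop (𝓝 x) := by
    rcases tendsto_of_slow_of_tendsto_zero hG hslow hwell with h0 | h0 | h0
    · exact hsaddle h0
    · exact hglobal G rfl h0
    · exact hglobal (-G) (neg_sq G) h0
  have hxM : x ⬝ᵥ x = M := tendsto_nhds_unique
    (((by fun_prop : Continuous fun v : Fin d → ℝ => v ⬝ᵥ v).tendsto x).comp hx) hM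
  have hx0 : x ≠ 0 := by
    rintro rfl
    rw [zero_dotProduct] at hxM
    exact hM0.ne hxM
  have hσx : σ x ≠ 0 := (hσpos x hx0).ne'
  have hσc : Continuous σ := by
    rw [funext hσ]; fun_prop
  have hyc : Tendsto (fun v => (v ⬝ᵥ g) / σ v) (𝓝 x) (𝓝 ((x ⬝ᵥ g) / σ x)) :=
    ((by fun_prop : Continuous fun v : Fin d → ℝ => v ⬝ᵥ g).tendsto x).div (hσc.tendsto x) hσx
  have hylim : Tendsto y atTop (𝓝 ((x ⬝ᵥ g) / σ x)) :=
    (hyc.comp hx).congr fun k => by rw [hy, hS]; rfl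
  have halim : Tendsto a atTop (𝓝 ((x ⬝ᵥ g) / σ x)) := by
    simpa using hδ.add hylim
  have hhc : Tendsto h (𝓝 x) (𝓝 (h x)) := by
    refine tendsto_const_nhds.sub (Tendsto.smul ?_ ?_)
    · exact ((by fun_prop : Continuous fun v : Fin d → ℝ => v ⬝ᵥ g).tendsto x).div
        ((hσc.pow 2).tendsto x) (pow_ne_zero 2 hσx)
    · exact (by fun_prop : Continuous fun v : Fin d → ℝ => H *ᵥ v).tendsto x
  refine ⟨(x ⬝ᵥ g) / σ x, x, hx0, halim, hx, rfl, ?_, Real.sqrt M, hM.sqrt⟩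
  have hlim : Tendsto (fun k => a k ^ 2 * p k) atTop
      (𝓝 (((x ⬝ᵥ g) / σ x) ^ 2 * (h x ⬝ᵥ h x))) := by
    simp only [hp]
    exact (halim.pow 2).mul
      (((by fun_prop : Continuous fun v : Fin d → ℝ => v ⬝ᵥ v).tendsto _).comp (hhc.comp hx))
  have hzero := tendsto_nhds_unique hlim hap
  refine dotProduct_self_eq_zero.1 (Eq.trans ?_ hzero)
  simp only [hh, smul_dotProduct, dotProduct_smul, smul_eq_mul]
  ring
end
end
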